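/- arXiv:1510.04727 — 2 statements merged into one kernel-verified Lean document; each statement's English description precedes it below -/
import Mathlib

section
/- There exists an absolute constant C₁ (one may take C₁ ≤ 32.42) with the following property. Let B be an n×n complex Hermitian positive semi-definite matrix with unit diagonal, λ₁ its largest eigenvalue, λ_r its smallest nonzero eigenvalue, κ̄ = λ₁/λ_r, b ∈ Ran(B), ȳ a solution of Bȳ = b, and ω ∈ (0,2). Then there exists a permutation σ of {1,…,n} such that the SOR iterates for the permuted system, y^{(k+1)} = y^{(k)} + ω P_σ*(I + ωL_σ)^{-1} P_σ (b − B y^{(k)}) (where L_σ is the strictly lower triangular part of P_σ B P_σ*), satisfy for all k ≥ 1: |ȳ − y^{(k)}|_B² ≤ (1 − ω(2−ω)λ₁ / ((1 + C₁ωλ₁)² κ̄))^k · |ȳ − y^{(0)}|_B². -/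
open Matrix
open scoped ComplexOrder

/-- Spectral (operator ℓ²→ℓ²) norm of a complex square matrix. -/
noncomputable def specNorm {n : ℕ} (M : Matrix (Fin n) (Fin n) ℂ) : ℝ :=
  ‖Matrix.toEuclideanCLM (𝕜 := ℂ) (n := Fin n) M‖

/-- Strictly lower triangular part of a matrix. -/
def lowerTri {n : ℕ} (M : Matrix (Fin n) (Fin n) ℂ) : Matrix (Fin n) (Fin n) ℂ :=
  Matrix.of fun i j => if j < i then M i j else 0

/-- Squared energy seminorm |y|_B² = ⟨By, y⟩. -/
noncomputable def energySq {n : ℕ} (B : Matrix (Fin n) (Fin n) ℂ) (y : Fin n → ℂ) : ℝ :=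
  (star y ⬝ᵥ (B *ᵥ y)).re

/-- Euclidean norm of a vector in ℂⁿ. -/
noncomputable def euclNorm {n : ℕ} (v : Fin n → ℂ) : ℝ :=
  ‖(WithLp.equiv 2 (Fin n → ℂ)).symm v‖

/-- One SOR sweep for the σ-permuted system, expressed in the original ordering:
v ↦ v + ω P_σ* (I + ω L_σ)⁻¹ P_σ (b − B v), where L_σ is the strictly lower
triangular part of P_σ B P_σ*. -/
noncomputable def sorStepPerm {n : ℕ} (B : Matrix (Fin n) (Fin n) ℂ) (ω : ℝ)
    (b : Fin n → ℂ) (σ : Equiv.Perm (Fin n)) (v : Fin n → ℂ) : Fin n → ℂ :=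
  v + (ω : ℂ) • fun i =>
    ((1 + (ω : ℂ) • lowerTri (B.submatrix σ σ))⁻¹ *ᵥ fun j => (b - B *ᵥ v) (σ j))
      (σ.symm i)


namespace MultiAffine

variable {I : Type*} [DecidableEq I]

/-- The partial derivative of a multi-affine function, written as a finite difference. -/
def pd (a : I) : Module.End ℂ ((I → ℂ) → ℂ) where
  toFun f z := f (Function.update z a 1) - f (Function.update z a 0)
  map_add' f g := by ext z; simp; ring
  map_smul' c f := by ext z; simp; ring

theorem pd_apply (a : I) (f : (I → ℂ) → ℂ) (z : I → ℂ) :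
    pd a f z = f (Function.update z a 1) - f (Function.update z a 0) := rfl

theorem pd_update (a : I) (f : (I → ℂ) → ℂ) (z : I → ℂ) (t : ℂ) :
    pd a f (Function.update z a t) = pd a f z := by
  simp [pd_apply]

theorem pd_mul_self (a : I) : pd a * pd a = 0 := by
  ext f z
  simp [pd_apply, Module.End.mul_apply]

theorem pd_comm (a b : I) : Commute (pd a) (pd b) := by
  by_cases h : a = b
  · subst h; exact Commute.refl _
  · ext f z
    simp only [Module.End.mul_apply, pd_apply, Function.update_comm h]
    ring

/-- The product of the partial derivatives in a list of variables. -/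
def top (l : List I) : Module.End ℂ ((I → ℂ) → ℂ) := (l.map pd).prod

/-- The sum over the positions in a list of the product of the other partial derivatives. -/
def cotop : List I → Module.End ℂ ((I → ℂ) → ℂ)
  | [] => 0
  | a :: l => pd a * cotop l + top l

/-- The sum of the partial derivatives in a list of variables. -/
def dsum (l : List I) : Module.End ℂ ((I → ℂ) → ℂ) := (l.map pd).sum

@[simp] theorem top_nil : top ([] : List I) = 1 := rfl

@[simp] theorem top_cons (a : I) (l : List I) : top (a :: l) = pd a * top l := by simp [top]

@[simp] theorem top_append (l m : List I) : top (l ++ m) = top l * top m := by simp [top]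

@[simp] theorem dsum_nil : dsum ([] : List I) = 0 := rfl

@[simp] theorem dsum_cons (a : I) (l : List I) : dsum (a :: l) = pd a + dsum l := by simp [dsum]

theorem Commute.top_right {T : Module.End ℂ ((I → ℂ) → ℂ)} (h : ∀ a, Commute T (pd a))
    (l : List I) : Commute T (top l) := by
  induction l with
  | nil => simp
  | cons a l ih => rw [top_cons]; exact (h a).mul_right ih

theorem Commute.dsum_right {T : Module.End ℂ ((I → ℂ) → ℂ)} (h : ∀ a, Commute T (pd a))
    (l : List I) : Commute T (dsum l) := by
  induction l with
  | nil => simp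
  | cons a l ih => rw [dsum_cons]; exact (h a).add_right ih

theorem Commute.cotop_right {T : Module.End ℂ ((I → ℂ) → ℂ)} (h : ∀ a, Commute T (pd a))
    (l : List I) : Commute T (cotop l) := by
  induction l with
  | nil => simp [cotop]
  | cons a l ih =>
    exact ((h a).mul_right ih).add_right (Commute.top_right h l)

theorem pd_top (a : I) (l : List I) : Commute (pd a) (top l) := Commute.top_right (pd_comm a) l

theorem pd_dsum (a : I) (l : List I) : Commute (pd a) (dsum l) := Commute.dsum_right (pd_comm a) l

theorem pd_cotop (a : I) (l : List I) : Commute (pd a) (cotop l) :=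
  Commute.cotop_right (pd_comm a) l

theorem add_pow_succ_of_sq_zero {R : Type*} [Ring R] {x d : R} (hx : x * x = 0)
    (h : Commute x d) (m : ℕ) : (x + d) ^ (m + 1) = d ^ (m + 1) + (m + 1 : ℕ) • (x * d ^ m) := by
  induction m with
  | zero => simp [add_comm]
  | succ m ih =>
    have h1 : d * (x * d ^ m) = x * d ^ (m + 1) := by
      rw [← mul_assoc, ← h.eq, mul_assoc, ← pow_succ']
    have h2 : x * (x * d ^ m) = 0 := by rw [← mul_assoc, hx, zero_mul]
    rw [pow_succ' (x + d), ih, add_mul, mul_add, mul_add, mul_smul_comm, mul_smul_comm, h1, h2,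
      ← pow_succ' d, succ_nsmul _ (m + 1)]
    simp only [smul_zero, add_zero]
    abel

theorem dsum_pow_length (l : List I) : dsum l ^ l.length = (l.length.factorial) • top l := by
  induction l with
  | nil => simp
  | cons a l ih =>
    have h0 : dsum l ^ (l.length + 1) = 0 := by
      clear ih
      induction l with
      | nil => simp
      | cons b l ih =>
        rw [dsum_cons, List.length_cons,
          add_pow_succ_of_sq_zero (pd_mul_self b) (pd_dsum b l), ih, pow_succ, ih]
        simp
    rw [dsum_cons, List.length_cons, add_pow_succ_of_sq_zero (pd_mul_self a) (pd_dsum a l), h0, ih,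
      top_cons, mul_smul_comm, smul_smul, zero_add, Nat.factorial_succ]

theorem dsum_pow_length_sub_one (a : I) (l : List I) :
    dsum (a :: l) ^ l.length = (l.length.factorial) • cotop (a :: l) := by
  induction l generalizing a with
  | nil => simp [cotop]
  | cons b l ih =>
    rw [dsum_cons, List.length_cons,
      add_pow_succ_of_sq_zero (pd_mul_self a) (pd_dsum a _), ih,
      ← List.length_cons (a := b), dsum_pow_length,
      show cotop (a :: b :: l) = pd a * cotop (b :: l) + top (b :: l) from rfl, smul_add,
      List.length_cons, mul_smul_comm, smul_smul, Nat.factorial_succ, add_comm]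

/-- Multi-affine continuous functions with real coefficients. -/
structure IsMA (f : (I → ℂ) → ℂ) : Prop where
  aff : ∀ a z, f z = f (Function.update z a 0) + z a * pd a f z
  cont : Continuous f
  real : ∀ z, f (fun i => starRingEnd ℂ (z i)) = starRingEnd ℂ (f z)

theorem IsMA.update_eq {f : (I → ℂ) → ℂ} (hf : IsMA f) (a : I) (z : I → ℂ) (t : ℂ) :
    f (Function.update z a (z a + t)) = f z + t * pd a f z := by
  rw [hf.aff a z, hf.aff a (Function.update z a (z a + t)), pd_update]
  simp
  ring

theorem IsMA.add {f g : (I → ℂ) → ℂ} (hf : IsMA f) (hg : IsMA g) : IsMA (f + g) where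
  aff a z := by
    simp only [map_add, Pi.add_apply]
    rw [hf.aff a z, hg.aff a z]; ring
  cont := hf.cont.add hg.cont
  real z := by simp [hf.real, hg.real]

theorem IsMA.zero : IsMA (0 : (I → ℂ) → ℂ) where
  aff a z := by simp
  cont := continuous_zero
  real z := by simp

theorem IsMA.pd {f : (I → ℂ) → ℂ} (hf : IsMA f) (a : I) : IsMA (pd a f) where
  aff b z := by
    by_cases h : b = a
    · subst h
      have := LinearMap.congr_fun (pd_mul_self b) f
      rw [Module.End.mul_apply] at this
      rw [pd_update, this]; simp
    · rw [pd_apply, hf.aff b, hf.aff b (Function.update z a 0)]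
      have e := congrFun (LinearMap.congr_fun (pd_comm b a).eq f) z
      simp only [Module.End.mul_apply] at e
      rw [e, pd_apply a, pd_apply a, Function.update_of_ne h, Function.update_of_ne h,
        Function.update_comm h, Function.update_comm h]
      ring
  cont := by
    have h1 : Continuous fun z : I → ℂ => Function.update z a (1 : ℂ) :=
      continuous_id.update a continuous_const
    have h0 : Continuous fun z : I → ℂ => Function.update z a (0 : ℂ) :=
      continuous_id.update a continuous_const
    exact (hf.cont.comp h1).sub (hf.cont.comp h0)
  real z := by
    have key : ∀ c : ℂ, starRingEnd ℂ c = c →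
        f (Function.update (fun i => starRingEnd ℂ (z i)) a c)
          = starRingEnd ℂ (f (Function.update z a c)) := by
      intro c hc
      rw [← hf.real]
      congr 1
      ext i
      by_cases h : i = a
      · subst h; simp [hc]
      · simp [h]
    rw [pd_apply, pd_apply, key 1 (by simp), key 0 (by simp), map_sub]

theorem IsMA.top {f : (I → ℂ) → ℂ} (hf : IsMA f) (l : List I) : IsMA (top l f) := by
  induction l with
  | nil => simpa
  | cons a l ih => rw [top_cons]; exact ih.pd a

theorem IsMA.dsum {f : (I → ℂ) → ℂ} (hf : IsMA f) (l : List I) : IsMA (dsum l f) := by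
  induction l with
  | nil => simpa using IsMA.zero
  | cons a l ih => rw [dsum_cons]; exact (hf.pd a).add ih

/-- Real stability for multi-affine functions, phrased so that it passes to derivatives:
wherever an iterated derivative vanishes on the open upper half-space, so do its own
partial derivatives. -/
structure IsStable (f : (I → ℂ) → ℂ) : Prop extends IsMA f where
  zero : ∀ (l : List I) (z : I → ℂ), (∀ i, 0 < (z i).im) → top l f z = 0 →
    ∀ a, pd a (top l f) z = 0

theorem IsStable.pd {f : (I → ℂ) → ℂ} (hf : IsStable f) (a : I) : IsStable (pd a f) where
  toIsMA := hf.toIsMA.pd a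
  zero l z hz h b := by
    have e : MultiAffine.top l (MultiAffine.pd a f) = MultiAffine.top (l ++ [a]) f := by
      simp [Module.End.mul_apply]
    rw [e] at h ⊢
    exact hf.zero _ z hz h b

theorem IsStable.top {f : (I → ℂ) → ℂ} (hf : IsStable f) (l : List I) :
    IsStable (top l f) := by
  induction l with
  | nil => simpa
  | cons a l ih => rw [top_cons]; exact ih.pd a

theorem IsStable.im_le {f : (I → ℂ) → ℂ} (hf : IsStable f) (a : I) (z : I → ℂ)
    (hz : ∀ i, 0 < (z i).im) :
    (z a).im * Complex.normSq (MultiAffine.pd a f z)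
      ≤ (f z * starRingEnd ℂ (MultiAffine.pd a f z)).im := by
  set g := MultiAffine.pd a f z with hg
  by_cases h0 : g = 0
  · simp [h0]
  have hN : 0 < Complex.normSq g := Complex.normSq_pos.2 h0
  have e : f z * starRingEnd ℂ g = (f z / g) * (Complex.normSq g : ℂ) := by
    rw [Complex.normSq_eq_conj_mul_self]; field_simp
  rw [e, Complex.im_mul_ofReal]
  refine mul_le_mul_of_nonneg_right ?_ hN.le
  by_contra hlt
  push Not at hlt
  apply h0
  have hv : f (Function.update z a (z a + -(f z / g))) = 0 := by
    rw [hf.update_eq, ← hg]; field_simp; ring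
  have := hf.zero [] (Function.update z a (z a + -(f z / g))) (by
    intro i
    by_cases hi : i = a
    · subst hi; simp; linarith
    · simpa [hi] using hz i) (by simpa using hv) a
  simpa [pd_update] using this

theorem IsStable.im_le_of_nonneg {f : (I → ℂ) → ℂ} (hf : IsStable f) (a : I) (z : I → ℂ)
    (hz : ∀ i, 0 ≤ (z i).im) :
    (z a).im * Complex.normSq (MultiAffine.pd a f z)
      ≤ (f z * starRingEnd ℂ (MultiAffine.pd a f z)).im := by
  have hc : Continuous fun ε : ℝ => (fun i => z i + ε * Complex.I : I → ℂ) := by fun_prop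
  have h1 : Continuous fun ε : ℝ =>
      (z a + ε * Complex.I).im *
        Complex.normSq (MultiAffine.pd a f (fun i => z i + ε * Complex.I)) := by
    have := (hf.toIsMA.pd a).cont.comp hc
    exact (Complex.continuous_im.comp (by fun_prop)).mul (Complex.continuous_normSq.comp this)
  have h2 : Continuous fun ε : ℝ => (f (fun i => z i + ε * Complex.I) *
      starRingEnd ℂ (MultiAffine.pd a f (fun i => z i + ε * Complex.I))).im := by
    have h3 := (hf.toIsMA.pd a).cont.comp hc
    exact Complex.continuous_im.comp
      ((hf.cont.comp hc).mul (Complex.continuous_conj.comp h3))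
  have t1 := (h1.tendsto 0).mono_left (nhdsWithin_le_nhds (s := Set.Ioi 0))
  have t2 := (h2.tendsto 0).mono_left (nhdsWithin_le_nhds (s := Set.Ioi 0))
  have := le_of_tendsto_of_tendsto t1 t2 (by
    filter_upwards [self_mem_nhdsWithin] with ε hε
    have hε' : (0 : ℝ) < ε := hε
    have hpos : ∀ i, 0 < (z i + ε * Complex.I).im := fun i => by
      simp only [Complex.add_im, Complex.mul_im, Complex.ofReal_re, Complex.I_im, mul_one,
        Complex.ofReal_im, Complex.I_re, mul_zero, add_zero]
      linarith [hz i]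
    exact hf.im_le a (fun i => z i + ε * Complex.I) hpos)
  simpa using this

theorem IsStable.dsum {f : (I → ℂ) → ℂ} (hf : IsStable f) (l : List I) :
    IsStable (dsum l f) where
  toIsMA := hf.toIsMA.dsum l
  zero m z hz h b := by
    have e : MultiAffine.top m (MultiAffine.dsum l f)
        = MultiAffine.dsum l (MultiAffine.top m f) := by
      have := (Commute.top_right (T := MultiAffine.dsum l)
        (fun a => (pd_dsum a l).symm) m).eq
      exact (LinearMap.congr_fun this f).symm
    rw [e] at h ⊢
    have hg := hf.top m
    set g := MultiAffine.top m f
    have hall : ∀ a ∈ l, MultiAffine.pd a g z = 0 := by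
      by_cases h0 : g z = 0
      · intro a _
        exact hg.zero [] z hz (by simpa using h0) a
      · have him : ∀ a, (z a).im * Complex.normSq (MultiAffine.pd a g z)
            ≤ (g z * starRingEnd ℂ (MultiAffine.pd a g z)).im := fun a => hg.im_le a z hz
        have hsum : (l.map fun a => (g z * starRingEnd ℂ (MultiAffine.pd a g z)).im).sum = 0 := by
          have : (g z * starRingEnd ℂ (MultiAffine.dsum l g z)).im = 0 := by simp [h]
          rw [← this]
          clear h this
          induction l with
          | nil => simp
          | cons a l ih =>
            simp only [List.map_cons, List.sum_cons, dsum_cons, LinearMap.add_apply,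
              Pi.add_apply, map_add, mul_add, Complex.add_im]
            rw [ih]
            exact (LinearMap.congr_fun (Commute.top_right (T := MultiAffine.dsum l)
              (fun a => (pd_dsum a l).symm) m).eq f).symm
        intro a ha
        have hnn : ∀ x ∈ l.map fun a => (g z * starRingEnd ℂ (MultiAffine.pd a g z)).im,
            0 ≤ x := by
          intro x hx
          obtain ⟨c, -, rfl⟩ := List.mem_map.1 hx
          exact (mul_nonneg (hz c).le (Complex.normSq_nonneg _)).trans (him c)
        have hle := List.single_le_sum hnn _ (List.mem_map.2 ⟨a, ha, rfl⟩)
        have := (him a).trans (hle.trans hsum.le)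
        have h4 : Complex.normSq (MultiAffine.pd a g z) ≤ 0 := by
          by_contra hc
          push Not at hc
          nlinarith [mul_pos (hz a) hc]
        exact Complex.normSq_eq_zero.1 (le_antisymm h4 (Complex.normSq_nonneg _))
    have e2 : MultiAffine.pd b (MultiAffine.dsum l g) z
        = (l.map fun a => MultiAffine.pd b (MultiAffine.pd a g) z).sum := by
      clear hall h e
      induction l with
      | nil => simp
      | cons a l ih => simp [ih]
    rw [e2]
    refine List.sum_eq_zero ?_
    intro x hx
    obtain ⟨a, ha, rfl⟩ := List.mem_map.1 hx
    exact (hg.pd a).zero [] z hz (by simpa using hall a ha) b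

theorem IsStable.smul {f : (I → ℂ) → ℂ} (hf : IsStable f) (c : ℝ) (hc : c ≠ 0) :
    IsStable ((c : ℂ) • f) where
  aff a z := by simp only [map_smul, Pi.smul_apply, smul_eq_mul]; rw [hf.aff a z]; ring
  cont := hf.cont.const_smul _
  real z := by simp [hf.real]
  zero l z hz h a := by
    have hc' : (c : ℂ) ≠ 0 := by exact_mod_cast hc
    simp only [map_smul, Pi.smul_apply, smul_eq_mul, mul_eq_zero, hc', false_or] at h ⊢
    exact hf.zero l z hz h a

theorem IsStable.cotop {f : (I → ℂ) → ℂ} (hf : IsStable f) (a : I) (l : List I) :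
    IsStable (cotop (a :: l) f) := by
  have h : ∀ k : ℕ, IsStable ((MultiAffine.dsum (a :: l) ^ k) f) := by
    intro k
    induction k with
    | zero => simpa
    | succ k ih => rw [pow_succ', Module.End.mul_apply]; exact ih.dsum _
  have h1 := h l.length
  rw [dsum_pow_length_sub_one] at h1
  have h2 := h1.smul ((l.length.factorial : ℝ)⁻¹) (by positivity)
  convert h2 using 1
  have hne : (l.length.factorial : ℂ) ≠ 0 := by exact_mod_cast Nat.factorial_ne_zero _
  rw [LinearMap.smul_apply, ← Nat.cast_smul_eq_nsmul ℂ, smul_smul]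
  simp [hne]

end MultiAffine

namespace MultiAffine

open Polynomial

theorem residue_im_nonpos {R G : ℝ[X]} {a : ℝ} {m : ℕ}
    (h : ∀ t : ℂ, 0 < t.im →
      (aeval t R * starRingEnd ℂ (aeval t ((X + C a) ^ m * G))).im ≤ 0)
    {u : ℂ} (hu : 0 < u.im) :
    (((R.eval (-a) * G.eval (-a) : ℝ) : ℂ) * starRingEnd ℂ (u ^ m)).im ≤ 0 := by
  have hc : Continuous fun ε : ℝ =>
      (aeval (-(a : ℂ) + ε * u) R * starRingEnd ℂ (u ^ m * aeval (-(a : ℂ) + ε * u) G)).im := by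
    have h1 : Continuous fun ε : ℝ => -(a : ℂ) + ε * u := by fun_prop
    have h2 := (R.continuous_aeval (A := ℂ)).comp h1
    have h3 := (G.continuous_aeval (A := ℂ)).comp h1
    exact Complex.continuous_im.comp
      (h2.mul (Complex.continuous_conj.comp (continuous_const.mul h3)))
  have t := (hc.tendsto 0).mono_left (nhdsWithin_le_nhds (s := Set.Ioi 0))
  have := le_of_tendsto t (b := 0) (by
    filter_upwards [self_mem_nhdsWithin] with ε hε
    have hε' : (0 : ℝ) < ε := hε
    have h0 := h (-(a : ℂ) + ε * u) (by simp; positivity)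
    have e : starRingEnd ℂ (aeval (-(a : ℂ) + ε * u) ((X + C a) ^ m * G))
        = ((ε ^ m : ℝ) : ℂ) * starRingEnd ℂ (u ^ m * aeval (-(a : ℂ) + ε * u) G) := by
      simp [mul_pow, mul_assoc]
    rw [e, mul_left_comm, Complex.im_ofReal_mul] at h0
    have : (0 : ℝ) < ε ^ m := by positivity
    by_contra hcon
    push Not at hcon
    exact absurd h0 (not_le.2 (mul_pos this hcon)))
  have e : ∀ P : ℝ[X], aeval (-(a : ℂ)) P = ((P.eval (-a) : ℝ) : ℂ) := by
    intro P
    have := aeval_algebraMap_apply ℂ (-a) P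
    simpa using this
  simp only [Complex.ofReal_zero, zero_mul, add_zero, e, map_mul, Complex.conj_ofReal] at this
  rw [Complex.ofReal_mul, mul_assoc, mul_comm ((G.eval (-a) : ℝ) : ℂ)]
  simpa using this

theorem exists_im_pos_pow_eq_I {m : ℕ} (hm : 1 ≤ m) : ∃ u : ℂ, 0 < u.im ∧ u ^ m = Complex.I := by
  have hm' : (0 : ℝ) < m := by exact_mod_cast hm
  refine ⟨Complex.exp (((Real.pi / 2 / m : ℝ) : ℂ) * Complex.I), ?_, ?_⟩
  · rw [Complex.exp_ofReal_mul_I_im]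
    refine Real.sin_pos_of_pos_of_lt_pi (by positivity) ?_
    have h1 : (1 : ℝ) ≤ m := by exact_mod_cast hm
    rw [div_lt_iff₀ hm']
    nlinarith [Real.pi_pos]
  · rw [← Complex.exp_nat_mul]
    have : (m : ℂ) * (((Real.pi / 2 / m : ℝ) : ℂ) * Complex.I) = Real.pi / 2 * Complex.I := by
      have : (m : ℂ) ≠ 0 := by exact_mod_cast hm'.ne'
      push_cast; field_simp
    rw [this, Complex.exp_pi_div_two_mul_I]

theorem exists_im_pos_pow_eq_neg_I {m : ℕ} (hm : 2 ≤ m) :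
    ∃ u : ℂ, 0 < u.im ∧ u ^ m = -Complex.I := by
  have hm1 : (2 : ℝ) ≤ m := by exact_mod_cast hm
  have hm' : (0 : ℝ) < m := by linarith
  refine ⟨Complex.exp (((3 * Real.pi / 2 / m : ℝ) : ℂ) * Complex.I), ?_, ?_⟩
  · rw [Complex.exp_ofReal_mul_I_im]
    refine Real.sin_pos_of_pos_of_lt_pi (by positivity) ?_
    rw [div_lt_iff₀ hm']
    nlinarith [Real.pi_pos]
  · rw [← Complex.exp_nat_mul]
    have : (m : ℂ) * (((3 * Real.pi / 2 / m : ℝ) : ℂ) * Complex.I)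
        = Real.pi * Complex.I + Real.pi / 2 * Complex.I := by
      have : (m : ℂ) ≠ 0 := by exact_mod_cast hm'.ne'
      push_cast; field_simp; ring
    rw [this, Complex.exp_add, Complex.exp_pi_mul_I, Complex.exp_pi_div_two_mul_I]
    simp

theorem residue_nonneg {R G : ℝ[X]} {a : ℝ} {m : ℕ} (hm : 1 ≤ m)
    (h : ∀ t : ℂ, 0 < t.im →
      (aeval t R * starRingEnd ℂ (aeval t ((X + C a) ^ m * G))).im ≤ 0) :
    0 ≤ R.eval (-a) * G.eval (-a) := by
  obtain ⟨u, hu, e⟩ := exists_im_pos_pow_eq_I hm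
  have := residue_im_nonpos h hu
  rw [e, Complex.im_ofReal_mul] at this
  simpa using this

theorem residue_nonpos {R G : ℝ[X]} {a : ℝ} {m : ℕ} (hm : 2 ≤ m)
    (h : ∀ t : ℂ, 0 < t.im →
      (aeval t R * starRingEnd ℂ (aeval t ((X + C a) ^ m * G))).im ≤ 0) :
    R.eval (-a) * G.eval (-a) ≤ 0 := by
  obtain ⟨u, hu, e⟩ := exists_im_pos_pow_eq_neg_I hm
  have := residue_im_nonpos h hu
  rw [e, Complex.im_ofReal_mul] at this
  simpa using this

/-- The case of simple roots of `coeff_mul_prod_le`. -/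
theorem coeff_mul_prod_le_of_simple (s : Finset ℝ) (R : ℝ[X]) (hR : R.degree < s.card)
    (hpos : ∀ a ∈ s, 0 < a)
    (hres : ∀ a ∈ s, 0 ≤ R.eval (-a) * ∏ b ∈ s.erase a, (b - a))
    (c : ℝ) (hc : ∀ a ∈ s, a ≤ c) :
    R.coeff (s.card - 1) * ∏ a ∈ s, a ≤ c * R.eval 0 := by
  have hinj : Set.InjOn (fun a : ℝ => -a) s := fun a _ b _ h => neg_injective h
  have h1 := Lagrange.coeff_eq_sum hinj hR
  have h2 : R.eval 0
      = ∑ a ∈ s, (∏ b ∈ s, b) * (a⁻¹ * (R.eval (-a) / ∏ b ∈ s.erase a, (b - a))) := by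
    conv_lhs => rw [Lagrange.eq_interpolate hinj hR]
    rw [Lagrange.eval_interpolate_not_at_node _ (fun a ha => by simpa using (hpos a ha).ne'),
      Lagrange.eval_nodal, Finset.mul_sum]
    refine Finset.sum_congr rfl fun a ha => ?_
    have e : ∀ b : ℝ, -a - -b = b - a := fun b => by ring
    simp only [Lagrange.nodalWeight, Finset.prod_inv_distrib, e, zero_sub, neg_neg]
    ring
  rw [h1, h2, Finset.sum_mul, Finset.mul_sum]
  refine Finset.sum_le_sum fun a ha => ?_
  have e : ∀ b : ℝ, -a - -b = b - a := fun b => by ring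
  simp only [e]
  have hw : 0 ≤ R.eval (-a) / ∏ b ∈ s.erase a, (b - a) := by
    have h3 := hres a ha
    rcases mul_nonneg_iff.1 h3 with ⟨p, q⟩ | ⟨p, q⟩
    · exact div_nonneg p q
    · exact div_nonneg_of_nonpos p q
  have hP : 0 ≤ ∏ b ∈ s, b := Finset.prod_nonneg fun b hb => (hpos b hb).le
  have h4 : 1 ≤ c * a⁻¹ := by
    rw [← div_eq_mul_inv, le_div_iff₀ (hpos a ha), one_mul]; exact hc a ha
  calc _ ≤ (c * a⁻¹) * (R.eval (-a) / (∏ b ∈ s.erase a, (b - a)) * ∏ b ∈ s, b) :=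
        le_mul_of_one_le_left (mul_nonneg hw hP) h4
    _ = _ := by ring

/-- A comparison of the leading and the constant coefficient for a polynomial `R` that is
interlaced by a polynomial with negative roots. -/
theorem coeff_mul_prod_le (s : Multiset ℝ) (R : ℝ[X]) (hR : R.degree < s.card)
    (hpos : ∀ a ∈ s, 0 < a)
    (h : ∀ t : ℂ, 0 < t.im → (aeval t R *
      starRingEnd ℂ (aeval t (s.map fun a : ℝ => X + C a).prod)).im ≤ 0)
    (c : ℝ) (hc : ∀ a ∈ s, a ≤ c) :
    R.coeff (s.card - 1) * s.prod ≤ c * R.eval 0 := by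
  induction hn : s.card generalizing s R with
  | zero =>
    rw [hn] at hR
    have : R = 0 := by
      rw [← degree_eq_bot]; exact Nat.WithBot.lt_zero_iff.1 (by simpa using hR)
    simp [this]
  | succ n ih =>
    by_cases hroot : ∃ a ∈ s, R.eval (-a) = 0
    · obtain ⟨a, ha, hRa⟩ := hroot
      obtain ⟨s₁, rfl⟩ := Multiset.exists_cons_of_mem ha
      obtain ⟨R₁, rfl⟩ : (X + C a) ∣ R := by
        have := dvd_iff_isRoot.2 (show IsRoot R (-a) from hRa)
        simpa using this
      have hcard : s₁.card = n := by simpa using hn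
      have hR₁ : R₁.degree < n := by
        rw [degree_mul, degree_X_add_C, Multiset.card_cons, hcard] at hR
        by_cases h0 : R₁ = 0
        · subst h0; simp
        · rw [degree_eq_natDegree h0] at hR ⊢
          have : ((1 + R₁.natDegree : ℕ) : WithBot ℕ) < ((n + 1 : ℕ) : WithBot ℕ) := by
            exact_mod_cast hR
          have h1 : 1 + R₁.natDegree < n + 1 := by exact_mod_cast this
          have h2 : R₁.natDegree < n := by omega
          exact_mod_cast h2
      have ih' := ih s₁ R₁ (hcard ▸ hR₁) (fun b hb => hpos b (Multiset.mem_cons_of_mem hb))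
        (fun t ht => by
          have h0 := h t ht
          rw [Multiset.map_cons, Multiset.prod_cons, map_mul, map_mul, map_mul] at h0
          set u := aeval t (X + C a : ℝ[X]) with hu
          have hu0 : u ≠ 0 := by
            intro h1
            have h2 : u.im = 0 := by rw [h1]; simp
            rw [hu] at h2
            simp at h2
            exact ht.ne' h2
          rw [show ∀ x y : ℂ, u * x * (starRingEnd ℂ u * y) = (Complex.normSq u : ℂ) * (x * y) by
            intro x y; rw [Complex.normSq_eq_conj_mul_self]; ring, Complex.im_ofReal_mul] at h0
          by_contra hcon
          push Not at hcon
          exact absurd h0 (not_le.2 (mul_pos (Complex.normSq_pos.2 hu0) hcon)))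
        (fun b hb => hc b (Multiset.mem_cons_of_mem hb)) hcard
      have ha0 := hpos a ha
      have hco : ((X + C a) * R₁).coeff (n + 1 - 1) = R₁.coeff (n - 1) := by
        cases n with
        | zero =>
          have : R₁ = 0 := by
            rw [← degree_eq_bot]; exact Nat.WithBot.lt_zero_iff.1 (by simpa using hR₁)
          simp [this]
        | succ k =>
          rw [add_mul, coeff_add, Nat.add_sub_cancel, coeff_X_mul, coeff_C_mul,
            coeff_eq_zero_of_degree_lt hR₁]
          simp
      rw [hco, Multiset.prod_cons, eval_mul]
      simp only [eval_add, eval_X, eval_C, zero_add]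
      nlinarith
    · push Not at hroot
      have hfac : ∀ a ∈ s, ∃ m, 1 ≤ m ∧ s.count a = m ∧ (s.map fun a : ℝ => X + C a).prod
          = (X + C a) ^ m * ((s.filter (· ≠ a)).map fun a : ℝ => X + C a).prod := by
        intro a ha
        refine ⟨s.count a, Multiset.one_le_count_iff_mem.2 ha, rfl, ?_⟩
        conv_lhs => rw [← Multiset.filter_add_not (fun b => b = a) s]
        rw [Multiset.map_add, Multiset.prod_add, Multiset.filter_eq']
        simp
      have heval : ∀ a, (((s.filter (· ≠ a)).map fun a : ℝ => X + C a).prod).eval (-a)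
          = ((s.filter (· ≠ a)).map fun b => b - a).prod := by
        intro a
        rw [eval_multiset_prod, Multiset.map_map]
        congr 1
        refine Multiset.map_congr rfl fun b _ => ?_
        simp; ring
      have hne : ∀ a, ((s.filter (· ≠ a)).map fun b => b - a).prod ≠ 0 := by
        intro a h0
        rw [Multiset.prod_eq_zero_iff, Multiset.mem_map] at h0
        obtain ⟨b, hb, hb'⟩ := h0
        exact (Multiset.mem_filter.1 hb).2 (sub_eq_zero.1 hb')
      have hnodup : s.Nodup := by
        rw [Multiset.nodup_iff_count_le_one]
        intro a
        by_contra hcon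
        push Not at hcon
        have ha : a ∈ s := Multiset.count_pos.1 (by omega)
        obtain ⟨m, hm, hcm, e⟩ := hfac a ha
        have h1 := residue_nonneg (R := R) hm (fun t ht => e ▸ h t ht)
        have h2 := residue_nonpos (R := R) (by omega : 2 ≤ m) (fun t ht => e ▸ h t ht)
        have h3 := le_antisymm h2 h1
        rw [heval] at h3
        exact (mul_ne_zero (hroot a ha) (hne a)) h3
      have key := coeff_mul_prod_le_of_simple (⟨s, hnodup⟩ : Finset ℝ) R hR hpos (by
        intro a ha
        obtain ⟨m, hm, -, e⟩ := hfac a ha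
        have h1 := residue_nonneg (R := R) hm (fun t ht => e ▸ h t ht)
        rw [heval] at h1
        convert h1 using 2
        rw [Finset.prod_eq_multiset_prod, Finset.erase_val, hnodup.erase_eq_filter]) c hc
      have e1 : (⟨s, hnodup⟩ : Finset ℝ).card = n + 1 := hn
      rw [e1, Finset.prod_eq_multiset_prod] at key
      simpa using key

variable {I : Type*} [DecidableEq I]

/-- A real point, regarded as a complex one. -/
def cplx (x : I → ℝ) : I → ℂ := fun i => (x i : ℂ)

/-- The real part of the value at a real point. -/
def val (f : (I → ℂ) → ℂ) (x : I → ℝ) : ℝ := (f (cplx x)).re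

theorem IsMA.ofReal_val {f : (I → ℂ) → ℂ} (hf : IsMA f) (x : I → ℝ) :
    ((val f x : ℝ) : ℂ) = f (cplx x) := by
  rw [val, ← Complex.conj_eq_iff_re, ← hf.real]
  congr 1
  ext i
  simp [cplx]

@[simp] theorem val_add {J : Type*} (f g : (J → ℂ) → ℂ) (x : J → ℝ) :
    val (f + g) x = val f x + val g x := by
  simp [val]

@[simp] theorem val_zero {J : Type*} (x : J → ℝ) : val (0 : (J → ℂ) → ℂ) x = 0 := by
  simp [val]

theorem IsStable.rayleigh {f : (I → ℂ) → ℂ} (hf : IsStable f) (a c : I) (x : I → ℝ) :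
    val f x * val (MultiAffine.pd a (MultiAffine.pd c f)) x
      ≤ val (MultiAffine.pd a f) x * val (MultiAffine.pd c f) x := by
  by_cases h : a = c
  · subst h
    have := LinearMap.congr_fun (pd_mul_self a) f
    rw [Module.End.mul_apply] at this
    rw [this]
    simpa using mul_self_nonneg _
  · have key := hf.im_le_of_nonneg a (Function.update (cplx x) c (cplx x c + Complex.I)) (by
      intro i
      by_cases hi : i = c
      · subst hi; simp [cplx]
      · simp [hi, cplx])
    rw [Function.update_of_ne h, hf.update_eq, (hf.toIsMA.pd a).update_eq,
      ← Module.End.mul_apply, (pd_comm c a).eq, Module.End.mul_apply,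
      ← hf.toIsMA.ofReal_val, ← (hf.toIsMA.pd a).ofReal_val, ← (hf.toIsMA.pd c).ofReal_val,
      ← ((hf.toIsMA.pd c).pd a).ofReal_val] at key
    simp [cplx] at key
    linarith

/-- Translation of the coordinates in a list. -/
def shift {R : Type*} [Add R] (l : List I) (t : R) (z : I → R) : I → R :=
  fun i => if i ∈ l then z i + t else z i

theorem cplx_shift (l : List I) (t : ℝ) (x : I → ℝ) :
    cplx (shift l t x) = shift l (t : ℂ) (cplx x) := by
  ext i
  by_cases h : i ∈ l <;> simp [cplx, shift, h]

theorem shift_cons {R : Type*} [Add R] {a : I} {l : List I} (h : a ∉ l) (t : R) (z : I → R) :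
    shift (a :: l) t z = Function.update (shift l t z) a (shift l t z a + t) := by
  ext i
  by_cases hi : i = a
  · subst hi; simp [shift, h]
  · simp [shift, hi]

theorem shift_append {R : Type*} [Add R] {l m : List I} (h : l.Disjoint m) (t : R) (z : I → R) :
    shift (l ++ m) t z = shift l t (shift m t z) := by
  ext i
  by_cases hi : i ∈ l
  · have : i ∉ m := h hi
    simp [shift, hi, this]
  · simp [shift, hi]

theorem IsMA.shift_cons {f : (I → ℂ) → ℂ} (hf : IsMA f) {a : I} {l : List I} (h : a ∉ l)
    (t : ℂ) (z : I → ℂ) :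
    f (shift (a :: l) t z) = f (shift l t z) + t * MultiAffine.pd a f (shift l t z) := by
  rw [MultiAffine.shift_cons h, hf.update_eq]

theorem IsMA.val_shift_cons {f : (I → ℂ) → ℂ} (hf : IsMA f) {a : I} {l : List I} (h : a ∉ l)
    (t : ℝ) (x : I → ℝ) :
    val f (shift (a :: l) t x)
      = val f (shift l t x) + t * val (MultiAffine.pd a f) (shift l t x) := by
  simp only [val, cplx_shift]
  rw [hf.shift_cons h]
  simp

theorem pd_shift_cons {a : I} {l : List I} (h : a ∉ l) (f : (I → ℂ) → ℂ) (t : ℂ) (z : I → ℂ) :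
    pd a f (shift (a :: l) t z) = pd a f (shift l t z) := by
  rw [shift_cons h, pd_update]

/-- The polynomial whose values are those of `f` at the translates of `x`. -/
noncomputable def diagPoly (x : I → ℝ) : List I → ((I → ℂ) → ℂ) → ℝ[X]
  | [], f => C (val f x)
  | a :: l, f => diagPoly x l f + X * diagPoly x l (pd a f)

theorem IsMA.aeval_diagPoly {f : (I → ℂ) → ℂ} (hf : IsMA f) (x : I → ℝ) {l : List I}
    (hl : l.Nodup) (t : ℂ) : aeval t (diagPoly x l f) = f (shift l t (cplx x)) := by
  induction l generalizing f with
  | nil =>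
    have : shift [] t (cplx x) = cplx x := by ext i; simp [shift]
    rw [this, ← hf.ofReal_val]; simp [diagPoly]
  | cons a l ih =>
    rw [List.nodup_cons] at hl
    rw [hf.shift_cons hl.1, diagPoly, map_add, map_mul, aeval_X, ih hf hl.2, ih (hf.pd a) hl.2]

theorem natDegree_diagPoly_le (x : I → ℝ) (l : List I) (f : (I → ℂ) → ℂ) :
    (diagPoly x l f).natDegree ≤ l.length := by
  induction l generalizing f with
  | nil => simp [diagPoly]
  | cons a l ih =>
    rw [diagPoly]
    refine natDegree_add_le_of_degree_le ((ih f).trans (Nat.le_succ _)) ?_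
    refine natDegree_mul_le.trans ?_
    rw [natDegree_X, List.length_cons, add_comm]
    exact Nat.succ_le_succ (ih _)

theorem top_pd (a : I) (l : List I) (f : (I → ℂ) → ℂ) : top l (pd a f) = pd a (top l f) :=
  (LinearMap.congr_fun (pd_top a l).eq f).symm

theorem cotop_pd (a : I) (l : List I) (f : (I → ℂ) → ℂ) : cotop l (pd a f) = pd a (cotop l f) :=
  (LinearMap.congr_fun (pd_cotop a l).eq f).symm

theorem top_cons_apply (a : I) (l : List I) (f : (I → ℂ) → ℂ) :
    top (a :: l) f = pd a (top l f) := by rw [top_cons, Module.End.mul_apply]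

theorem cotop_cons_apply (a : I) (l : List I) (f : (I → ℂ) → ℂ) :
    cotop (a :: l) f = pd a (cotop l f) + top l f := rfl

theorem coeff_length_diagPoly (x : I → ℝ) (l : List I) (f : (I → ℂ) → ℂ) :
    (diagPoly x l f).coeff l.length = val (top l f) x := by
  induction l generalizing f with
  | nil => simp [diagPoly]
  | cons a l ih =>
    rw [diagPoly, List.length_cons, coeff_add, coeff_X_mul, ih, coeff_eq_zero_of_natDegree_lt
      (Nat.lt_succ_of_le (natDegree_diagPoly_le x l f)), zero_add, top_pd, top_cons_apply]

theorem coeff_length_sub_one_diagPoly (x : I → ℝ) (a : I) (l : List I) (f : (I → ℂ) → ℂ) :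
    (diagPoly x (a :: l) f).coeff l.length = val (cotop (a :: l) f) x := by
  induction l generalizing a f with
  | nil => simp [diagPoly, cotop]
  | cons b l ih =>
    rw [diagPoly, coeff_add, coeff_length_diagPoly, List.length_cons, coeff_X_mul, ih, cotop_pd,
      cotop_cons_apply a, val_add, add_comm]

theorem coeff_zero_diagPoly (x : I → ℝ) (l : List I) (f : (I → ℂ) → ℂ) :
    (diagPoly x l f).coeff 0 = val f x := by
  induction l generalizing f with
  | nil => simp [diagPoly]
  | cons a l ih => simp [diagPoly, ih]

theorem coeff_one_diagPoly (x : I → ℝ) (l : List I) (f : (I → ℂ) → ℂ) :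
    (diagPoly x l f).coeff 1 = val (dsum l f) x := by
  induction l generalizing f with
  | nil => simp [diagPoly]
  | cons a l ih =>
    rw [diagPoly, coeff_add, ih, show (1 : ℕ) = 0 + 1 from rfl, coeff_X_mul, coeff_zero_diagPoly,
      dsum_cons, LinearMap.add_apply, val_add, add_comm]

theorem IsStable.top_eq_zero_of_shift {f : (I → ℂ) → ℂ} (hf : IsStable f) (x : I → ℝ)
    {l : List I} (hl : l.Nodup) {t : ℂ} (ht : 0 < t.im) (h : f (shift l t (cplx x)) = 0) :
    MultiAffine.top l f (cplx x) = 0 := by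
  induction l generalizing f with
  | nil =>
    have : shift [] t (cplx x) = cplx x := by ext i; simp [shift]
    simpa [this] using h
  | cons a l ih =>
    rw [List.nodup_cons] at hl
    have key := hf.im_le_of_nonneg a (shift (a :: l) t (cplx x)) (by
      intro i
      by_cases hi : i ∈ a :: l
      · simp only [shift, hi, if_true, cplx, Complex.add_im, Complex.ofReal_im, zero_add]
        exact ht.le
      · simp [shift, hi, cplx])
    rw [h, pd_shift_cons hl.1] at key
    have e : (shift (a :: l) t (cplx x) a).im = t.im := by simp [shift, cplx]
    rw [e] at key
    simp only [zero_mul, Complex.zero_im] at key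
    have h0 : Complex.normSq (MultiAffine.pd a f (shift l t (cplx x))) ≤ 0 := by
      by_contra hc
      push Not at hc
      nlinarith [mul_pos ht hc]
    have := ih (hf.pd a) hl.2 (Complex.normSq_eq_zero.1 (le_antisymm h0 (Complex.normSq_nonneg _)))
    rwa [top_pd, ← top_cons_apply] at this

/-- All iterated derivatives in distinct variables from `N` are positive at `x`. -/
def Pos (f : (I → ℂ) → ℂ) (N : Set I) (x : I → ℝ) : Prop :=
  ∀ l : List I, l.Nodup → (∀ a ∈ l, a ∈ N) → 0 < val (top l f) x

theorem Pos.val_pos {f : (I → ℂ) → ℂ} {N : Set I} {x : I → ℝ} (h : Pos f N x) : 0 < val f x := by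
  simpa using h [] List.nodup_nil (by simp)

theorem Pos.mono {f : (I → ℂ) → ℂ} {N M : Set I} {x : I → ℝ} (h : Pos f N x) (hM : M ⊆ N) :
    Pos f M x := fun l hl hm => h l hl fun a ha => hM (hm a ha)

theorem Pos.pd {f : (I → ℂ) → ℂ} {N : Set I} {x : I → ℝ} (h : Pos f N x) {a : I} (ha : a ∈ N) :
    Pos (pd a f) (N \ {a}) x := by
  intro l hl hm
  rw [top_pd, ← top_cons_apply]
  refine h _ (List.nodup_cons.2 ⟨fun hal => (hm a hal).2 rfl, hl⟩) ?_
  intro b hb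
  rcases List.mem_cons.1 hb with rfl | hb
  · exact ha
  · exact (hm b hb).1

theorem Pos.top {f : (I → ℂ) → ℂ} {N : Set I} {x : I → ℝ} (h : Pos f N x) {m : List I}
    (hm : m.Nodup) (hmN : ∀ a ∈ m, a ∈ N) : Pos (top m f) (N \ {a | a ∈ m}) x := by
  intro l hl hlm
  rw [← Module.End.mul_apply, ← top_append]
  refine h _ (List.nodup_append'.2 ⟨hl, hm, fun a ha hb => (hlm a ha).2 hb⟩) ?_
  intro b hb
  rcases List.mem_append.1 hb with hb | hb
  · exact (hlm b hb).1
  · exact hmN b hb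

theorem Pos.val_shift_pos {f : (I → ℂ) → ℂ} (hf : IsMA f) {N : Set I} {x : I → ℝ} (h : Pos f N x)
    {l : List I} (hl : l.Nodup) (hlN : ∀ a ∈ l, a ∈ N) {t : ℝ} (ht : 0 ≤ t) :
    0 < val f (shift l t x) := by
  induction l generalizing f N with
  | nil =>
    have : shift [] t x = x := by ext i; simp [shift]
    rw [this]; exact h.val_pos
  | cons a l ih =>
    rw [List.nodup_cons] at hl
    rw [hf.val_shift_cons hl.1]
    have h1 := ih hf h hl.2 fun b hb => hlN b (List.mem_cons_of_mem _ hb)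
    have h2 := ih (hf.pd a) (h.pd (hlN a List.mem_cons_self)) hl.2 fun b hb =>
      ⟨hlN b (List.mem_cons_of_mem _ hb),
        fun e => hl.1 (by rw [Set.mem_singleton_iff] at e; rwa [← e])⟩
    positivity

theorem IsMA.eval_diagPoly {f : (I → ℂ) → ℂ} (hf : IsMA f) (x : I → ℝ) {l : List I}
    (hl : l.Nodup) (t : ℝ) : (diagPoly x l f).eval t = val f (shift l t x) := by
  have h1 := hf.aeval_diagPoly x hl (t : ℂ)
  have h2 := aeval_algebraMap_apply ℂ t (diagPoly x l f)
  simp only [Complex.coe_algebraMap, coe_aeval_eq_eval] at h2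
  rw [h2, ← cplx_shift] at h1
  rw [val, ← h1, Complex.ofReal_re]

theorem sq_card_le_sum_mul_sum_inv (s : Multiset ℝ) (hs : ∀ a ∈ s, 0 < a) :
    (s.card : ℝ) ^ 2 ≤ s.sum * (s.map fun a => a⁻¹).sum := by
  induction s using Multiset.induction_on with
  | empty => simp
  | cons a s ih =>
    have ih' := ih fun b hb => hs b (Multiset.mem_cons_of_mem hb)
    have ha := hs a (Multiset.mem_cons_self a s)
    have hA : 0 ≤ s.sum := Multiset.sum_nonneg fun b hb => (hs b (Multiset.mem_cons_of_mem hb)).le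
    have hB : 0 ≤ (s.map fun a => a⁻¹).sum := by
      refine Multiset.sum_nonneg fun b hb => ?_
      obtain ⟨c, hc, rfl⟩ := Multiset.mem_map.1 hb
      exact (inv_pos.2 (hs c (Multiset.mem_cons_of_mem hc))).le
    simp only [Multiset.card_cons, Multiset.sum_cons, Multiset.map_cons]
    set A := s.sum
    set D := (s.map fun a => a⁻¹).sum
    have hn : (0 : ℝ) ≤ s.card := Nat.cast_nonneg _
    have h1 : 2 * (s.card : ℝ) ≤ a * D + A * a⁻¹ := by
      have h2 : (a * D) * (A * a⁻¹) = A * D := by field_simp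
      have h3 : 0 ≤ a * D := by positivity
      have h4 : 0 ≤ A * a⁻¹ := by positivity
      refine abs_le_of_sq_le_sq' ?_ (by positivity) |>.2
      nlinarith [sq_nonneg (a * D - A * a⁻¹)]
    have h5 : a * a⁻¹ = 1 := mul_inv_cancel₀ ha.ne'
    push_cast
    nlinarith

theorem coeff_zero_prod_X_add_C (s : Multiset ℝ) :
    (s.map fun a : ℝ => X + C a).prod.coeff 0 = s.prod := by
  rw [coeff_zero_eq_eval_zero, eval_multiset_prod, Multiset.map_map]
  simp

theorem coeff_one_prod_X_add_C (s : Multiset ℝ) (hs : ∀ a ∈ s, 0 < a) :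
    (s.map fun a : ℝ => X + C a).prod.coeff 1 = s.prod * (s.map fun a => a⁻¹).sum := by
  induction s using Multiset.induction_on with
  | empty => simp [coeff_one]
  | cons a s ih =>
    have ih' := ih fun b hb => hs b (Multiset.mem_cons_of_mem hb)
    have ha := (hs a (Multiset.mem_cons_self a s)).ne'
    simp only [Multiset.map_cons, Multiset.prod_cons, Multiset.sum_cons]
    rw [add_mul, coeff_add, show (1 : ℕ) = 0 + 1 from rfl, coeff_X_mul, coeff_C_mul,
      coeff_zero_prod_X_add_C, zero_add, ih']
    field_simp

theorem coeff_pred_prod_X_add_C (s : Multiset ℝ) (a : ℝ) :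
    ((a ::ₘ s).map fun a : ℝ => X + C a).prod.coeff s.card = (a ::ₘ s).sum := by
  rw [Multiset.prod_X_add_C_coeff _ (by simp)]
  simp [Multiset.esymm, Multiset.powersetCard_one, add_comm]

/-- The polynomial `diagPoly` has only negative roots. -/
theorem exists_diagPoly_eq {f : (I → ℂ) → ℂ} (hf : IsStable f) {N : Set I} {x : I → ℝ}
    (h : Pos f N x) {l : List I} (hl : l.Nodup) (hlN : ∀ a ∈ l, a ∈ N) :
    ∃ s : Multiset ℝ, s.card = l.length ∧ (∀ a ∈ s, 0 < a) ∧
      diagPoly x l f = C (val (top l f) x) * (s.map fun a : ℝ => X + C a).prod := by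
  set G := diagPoly x l f with hG
  have htop := h l hl hlN
  have hdeg : G.natDegree = l.length :=
    natDegree_eq_of_le_of_coeff_ne_zero (natDegree_diagPoly_le x l f)
      (by rw [coeff_length_diagPoly]; exact htop.ne')
  have hlead : G.leadingCoeff = val (top l f) x := by
    rw [leadingCoeff, hdeg, coeff_length_diagPoly]
  have hG0 : G ≠ 0 := by
    intro h0
    rw [h0] at hlead
    simp at hlead
    exact htop.ne hlead
  have hnv : ∀ t : ℂ, 0 < t.im → aeval t G ≠ 0 := by
    intro t ht h0
    rw [hf.toIsMA.aeval_diagPoly x hl] at h0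
    have := hf.top_eq_zero_of_shift x hl ht h0
    rw [← (hf.toIsMA.top l).ofReal_val] at this
    exact htop.ne' (by exact_mod_cast this)
  have hnv' : ∀ t : ℂ, aeval t G = 0 → t.im = 0 := by
    intro t h0
    rcases lt_trichotomy t.im 0 with hlt | heq | hgt
    · exfalso
      refine hnv (starRingEnd ℂ t) (by simpa using hlt) ?_
      rw [aeval_conj, h0, map_zero]
    · exact heq
    · exact absurd h0 (hnv t hgt)
  have hsplit : G.Splits := by
    refine Splits.of_splits_map (algebraMap ℝ ℂ) (IsAlgClosed.splits _) ?_
    intro t ht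
    have h0 : aeval t G = 0 := by
      rw [mem_roots', IsRoot, eval_map_algebraMap] at ht
      exact ht.2
    exact ⟨t.re, by apply Complex.ext <;> simp [hnv' t h0]⟩
  refine ⟨G.roots.map fun a => -a, ?_, ?_, ?_⟩
  · rw [Multiset.card_map, ← hsplit.natDegree_eq_card_roots, hdeg]
  · intro a ha
    obtain ⟨b, hb, rfl⟩ := Multiset.mem_map.1 ha
    have hb0 : G.eval b = 0 := (mem_roots'.1 hb).2
    by_contra hcon
    push Not at hcon
    have := h.val_shift_pos hf.toIsMA hl hlN (t := b) (by linarith)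
    rw [← hf.toIsMA.eval_diagPoly x hl, ← hG, hb0] at this
    exact lt_irrefl _ this
  · conv_lhs => rw [hsplit.eq_prod_roots]
    rw [hlead, Multiset.map_map]
    congr 2
    refine Multiset.map_congr rfl fun b _ => ?_
    simp [sub_eq_add_neg]

theorem val_dsum (l : List I) (f : (I → ℂ) → ℂ) (x : I → ℝ) :
    val (dsum l f) x = (l.map fun a => val (pd a f) x).sum := by
  induction l with
  | nil => simp
  | cons a l ih => simp [ih]

theorem val_top_shift {f : (I → ℂ) → ℂ} (hf : IsMA f) {m l : List I} (hml : ∀ a ∈ m, a ∈ l)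
    (hm : m.Nodup) (t : ℝ) (x : I → ℝ) :
    val (top l f) (shift m t x) = val (top l f) x := by
  induction m with
  | nil => congr 1
  | cons a m ih =>
    rw [List.nodup_cons] at hm
    have ha : a ∈ l := hml a List.mem_cons_self
    have : pd a (top l f) = 0 := by
      obtain ⟨l₁, l₂, rfl⟩ := List.append_of_mem ha
      have e := LinearMap.congr_fun (pd_top a l₁).eq
      simp only [Module.End.mul_apply] at e
      rw [top_append, Module.End.mul_apply, e, top_cons_apply]
      have := LinearMap.congr_fun (pd_mul_self a) (top l₂ f)
      rw [Module.End.mul_apply] at this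
      rw [this]; simp
    rw [(hf.top l).val_shift_cons hm.1, this,
      ih (fun b hb => hml b (List.mem_cons_of_mem _ hb)) hm.2]
    simp

theorem val_cotop_shift {f : (I → ℂ) → ℂ} (hf : IsMA f) {l : List I} (hl : l.Nodup)
    (t : ℝ) (x : I → ℝ) :
    val (cotop l f) (shift l t x) = val (cotop l f) x + t * l.length * val (top l f) x := by
  induction l generalizing f with
  | nil => simp [cotop]
  | cons a l ih =>
    have hl' := List.nodup_cons.1 hl
    have e2 : val (pd a (cotop l f)) (shift (a :: l) t x)
        = val (pd a (cotop l f)) (shift l t x) := by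
      rw [val, cplx_shift, pd_shift_cons hl'.1, ← cplx_shift, val]
    have e3 := ih (hf.pd a) hl'.2
    rw [cotop_pd, top_pd] at e3
    rw [cotop_cons_apply, val_add, val_add, e2, e3,
      (hf.top l).val_shift_cons hl'.1, val_top_shift hf (fun _ h => h) hl'.2,
      ← top_cons_apply, val_top_shift hf (fun b hb => List.mem_cons_of_mem _ hb) hl'.2]
    push_cast [List.length_cons]
    ring

/-- The barrier estimate for one block of variables. -/
theorem barrier_step {f : (I → ℂ) → ℂ} (hf : IsStable f) {N : Set I} {x : I → ℝ}
    (h : Pos f N x) {a₀ : I} {l₀ : List I} (hl : (a₀ :: l₀).Nodup) (hlN : ∀ a ∈ a₀ :: l₀, a ∈ N)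
    {φ δ : ℝ} (hφ : 0 < φ) (hΦ : ∀ j ∈ a₀ :: l₀, val (pd j f) x ≤ φ * val f x)
    (hδ : ((l₀.length : ℝ) + 1) ^ 2 * φ * δ ≤ (l₀.length : ℝ) ^ 2) :
    0 < val (cotop (a₀ :: l₀) f) (shift (a₀ :: l₀) (-δ) x) ∧
      ∀ c, c ∉ a₀ :: l₀ → val (pd c (cotop (a₀ :: l₀) f)) (shift (a₀ :: l₀) (-δ) x) * val f x
        ≤ val (pd c f) x * val (cotop (a₀ :: l₀) f) (shift (a₀ :: l₀) (-δ) x) := by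
  obtain ⟨s, hcard, hspos, hfac⟩ := exists_diagPoly_eq hf h hl hlN
  set l := a₀ :: l₀ with hldef
  have hlen : l.length = l₀.length + 1 := rfl
  set L := val (top l f) x with hL
  have hLpos : 0 < L := h l hl hlN
  have hfpos := h.val_pos
  set r : ℝ := (l₀.length : ℝ) + 1 with hr
  have e0 : val f x = L * s.prod := by
    rw [← coeff_zero_diagPoly x l f, hfac, coeff_C_mul, coeff_zero_prod_X_add_C]
  have e1 : val (dsum l f) x = L * (s.prod * (s.map fun a => a⁻¹).sum) := by
    rw [← coeff_one_diagPoly x l f, hfac, coeff_C_mul, coeff_one_prod_X_add_C s hspos]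
  have e2 : val (cotop l f) x = L * s.sum := by
    rw [hldef, ← coeff_length_sub_one_diagPoly, ← hldef, hfac, coeff_C_mul]
    obtain ⟨a, ha⟩ : ∃ a, a ∈ s := by
      rw [← Multiset.card_pos_iff_exists_mem, hcard, hlen]; omega
    obtain ⟨s', rfl⟩ := Multiset.exists_cons_of_mem ha
    have : s'.card = l₀.length := by simpa [hlen] using hcard
    rw [← this, coeff_pred_prod_X_add_C]
  have hinv : (s.map fun a => a⁻¹).sum ≤ r * φ := by
    have h1 : val (dsum l f) x ≤ r * φ * val f x := by
      rw [val_dsum]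
      have := List.sum_le_card_nsmul (l.map fun a => val (pd a f) x) (φ * val f x) (by
        intro y hy
        obtain ⟨a, ha, rfl⟩ := List.mem_map.1 hy
        exact hΦ a ha)
      rw [List.length_map, hlen, nsmul_eq_mul] at this
      push_cast at this
      rw [hr]
      linarith
    rw [e1, ← mul_assoc, ← e0, mul_comm] at h1
    exact le_of_mul_le_mul_right h1 hfpos
  set c₀ := s.sum - r * δ with hc₀
  have hle : ∀ a ∈ s, a ≤ c₀ := by
    intro a ha
    obtain ⟨s', rfl⟩ := Multiset.exists_cons_of_mem ha
    have hs' : ∀ b ∈ s', 0 < b := fun b hb => hspos b (Multiset.mem_cons_of_mem hb)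
    have h1 := sq_card_le_sum_mul_sum_inv s' hs'
    have h2 : s'.card = l₀.length := by simpa [hlen] using hcard
    have h3 : 0 ≤ s'.sum := Multiset.sum_nonneg fun b hb => (hs' b hb).le
    have ha0 : 0 < a⁻¹ := inv_pos.2 (hspos a ha)
    rw [Multiset.map_cons, Multiset.sum_cons] at hinv
    rw [h2] at h1
    have h4 : s'.sum * (s'.map fun a => a⁻¹).sum ≤ s'.sum * (r * φ) :=
      mul_le_mul_of_nonneg_left (by linarith) h3
    have hr0 : 0 < r := by positivity
    have h5 : (r * φ) * (r * δ) ≤ (r * φ) * s'.sum := by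
      calc (r * φ) * (r * δ) = r ^ 2 * φ * δ := by ring
        _ ≤ _ := hδ.trans (h1.trans (h4.trans (mul_comm _ _).le))
    have h6 := le_of_mul_le_mul_left h5 (by positivity)
    rw [hc₀, Multiset.sum_cons]
    linarith
  have hc₀pos : 0 < c₀ := by
    obtain ⟨a, ha⟩ : ∃ a, a ∈ s := by
      rw [← Multiset.card_pos_iff_exists_mem, hcard, hlen]; omega
    exact (hspos a ha).trans_le (hle a ha)
  have hlr : (l.length : ℝ) = r := by rw [hlen]; push_cast; rfl
  have eP : val (cotop l f) (shift l (-δ) x) = L * c₀ := by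
    rw [val_cotop_shift hf.toIsMA hl, e2, hlr, hc₀]; ring
  refine ⟨eP ▸ mul_pos hLpos hc₀pos, ?_⟩
  intro c hc
  set κ := val (top l (pd c f)) x / L with hκ
  set Q := (s.map fun a : ℝ => X + C a).prod with hQ
  set R := C L⁻¹ * (diagPoly x l (pd c f) - C κ * diagPoly x l f) with hR
  have hRn : R.natDegree ≤ l.length := by
    refine (natDegree_C_mul_le _ _).trans ((natDegree_sub_le _ _).trans
      (max_le (natDegree_diagPoly_le _ _ _) ?_))
    exact (natDegree_C_mul_le _ _).trans (natDegree_diagPoly_le _ _ _)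
  have hRc : R.coeff l.length = 0 := by
    rw [hR, coeff_C_mul, coeff_sub, coeff_C_mul, coeff_length_diagPoly, coeff_length_diagPoly, ← hL,
      hκ]
    field_simp
    simp
  have hRdeg : R.degree < s.card := by
    rw [hcard]
    refine (degree_lt_iff_coeff_zero _ _).2 fun m hm => ?_
    rcases hm.eq_or_lt with rfl | hm
    · exact hRc
    · exact coeff_eq_zero_of_natDegree_lt (hRn.trans_lt hm)
  have key := coeff_mul_prod_le s R hRdeg hspos (by
    intro t ht
    have him := hf.im_le_of_nonneg c (shift l t (cplx x)) (by
      intro i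
      by_cases hi : i ∈ l
      · simp only [shift, hi, if_true, cplx, Complex.add_im, Complex.ofReal_im, zero_add]
        exact ht.le
      · simp [shift, hi, cplx])
    have e : (shift l t (cplx x) c).im = 0 := by simp [shift, cplx, hc]
    rw [e, zero_mul, ← hf.toIsMA.aeval_diagPoly x hl, ← (hf.toIsMA.pd c).aeval_diagPoly x hl,
      hfac] at him
    rw [hR, hfac]
    simp only [map_mul, map_sub, aeval_C, Complex.coe_algebraMap] at him ⊢
    rw [Complex.mul_im, Complex.mul_im] at *
    simp only [Complex.mul_re, Complex.mul_im, Complex.sub_re, Complex.sub_im, Complex.ofReal_re,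
      Complex.ofReal_im, Complex.conj_re, Complex.conj_im] at him ⊢
    set qr := (aeval t Q).re
    set qi := (aeval t Q).im
    set gr := (aeval t (diagPoly x l (pd c f))).re
    set gi := (aeval t (diagPoly x l (pd c f))).im
    have h1 : 0 ≤ L * (qi * gr - qr * gi) := by linarith
    have h2 : 0 ≤ qi * gr - qr * gi := by
      by_contra hcon
      push Not at hcon
      nlinarith
    have h3 : 0 ≤ L⁻¹ * (qi * gr - qr * gi) := mul_nonneg (inv_pos.2 hLpos).le h2
    ring_nf at h3 ⊢
    linarith) c₀ hle
  have hR0 : R.eval 0 = L⁻¹ * (val (pd c f) x - κ * val f x) := by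
    rw [← coeff_zero_eq_eval_zero, hR, coeff_C_mul, coeff_sub, coeff_C_mul, coeff_zero_diagPoly,
      coeff_zero_diagPoly]
  have hR1 : R.coeff (s.card - 1) = L⁻¹ * (val (cotop l (pd c f)) x - κ * (L * s.sum)) := by
    rw [hcard, hlen, Nat.add_sub_cancel, hR, coeff_C_mul, coeff_sub, coeff_C_mul, hldef,
      coeff_length_sub_one_diagPoly, coeff_length_sub_one_diagPoly, ← hldef, e2]
  have eG : val (pd c (cotop l f)) (shift l (-δ) x)
      = val (cotop l (pd c f)) x + (-δ) * r * (κ * L) := by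
    rw [← cotop_pd, val_cotop_shift (hf.toIsMA.pd c) hl, hlr, hκ]
    field_simp
  rw [hR0, hR1] at key
  have e3 : s.prod = L⁻¹ * val f x := by rw [e0]; field_simp
  rw [e3] at key
  have key2 := mul_le_mul_of_nonneg_left key (mul_pos hLpos hLpos).le
  have hLi : L * L⁻¹ = 1 := mul_inv_cancel₀ hLpos.ne'
  have e4 : L * L * (L⁻¹ * (val (cotop l (pd c f)) x - κ * (L * s.sum)) * (L⁻¹ * val f x))
      = (L * L⁻¹) * (L * L⁻¹) * (val (cotop l (pd c f)) x - κ * (L * s.sum)) * val f x := by ring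
  have e5 : L * L * (c₀ * (L⁻¹ * (val (pd c f) x - κ * val f x)))
      = (L * L⁻¹) * L * (c₀ * (val (pd c f) x - κ * val f x)) := by ring
  rw [e4, e5, hLi] at key2
  rw [eG, eP, hc₀]
  rw [hc₀] at key2
  linarith

theorem cotop_top (l m : List I) (f : (I → ℂ) → ℂ) :
    cotop l (top m f) = top m (cotop l f) :=
  LinearMap.congr_fun (Commute.top_right (T := cotop l) (fun a => (pd_cotop a l).symm) m).eq f

/-- A stable function, positive together with its derivatives at a point, whose logarithmic
derivatives there are at most `φ`. -/
structure Barrier (f : (I → ℂ) → ℂ) (N : Set I) (φ : ℝ) (x : I → ℝ) : Prop where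
  stable : IsStable f
  pos : Pos f N x
  le : ∀ j ∈ N, val (pd j f) x ≤ φ * val f x

theorem Barrier.top {f : (I → ℂ) → ℂ} {N : Set I} {φ : ℝ} {x : I → ℝ} (h : Barrier f N φ x)
    {m : List I} (hm : m.Nodup) (hmN : ∀ a ∈ m, a ∈ N) :
    Barrier (top m f) (N \ {a | a ∈ m}) φ x where
  stable := h.stable.top m
  pos := h.pos.top hm hmN
  le := by
    intro j hj
    replace hj := hj.1
    induction m with
    | nil => simpa using h.le j hj
    | cons a m ih =>
      have hm' := List.nodup_cons.1 hm
      have ih' := ih hm'.2 fun b hb => hmN b (List.mem_cons_of_mem _ hb)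
      have h1 : 0 < val (MultiAffine.top m f) x :=
        h.pos m hm'.2 fun b hb => hmN b (List.mem_cons_of_mem _ hb)
      have h2 : 0 < val (MultiAffine.top (a :: m) f) x := h.pos _ hm hmN
      have h3 := (h.stable.top m).rayleigh j a x
      rw [top_cons_apply] at h2 ⊢
      have h4 := mul_le_mul_of_nonneg_right ih' h2.le
      by_contra hcon
      push Not at hcon
      nlinarith [mul_lt_mul_of_pos_left hcon h1]

theorem Barrier.cotop {f : (I → ℂ) → ℂ} {N : Set I} {φ δ : ℝ} {x : I → ℝ} (h : Barrier f N φ x)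
    {a : I} {l : List I} (hl : (a :: l).Nodup) (hlN : ∀ b ∈ a :: l, b ∈ N) (hφ : 0 < φ)
    (hδ : ((l.length : ℝ) + 1) ^ 2 * φ * δ ≤ (l.length : ℝ) ^ 2) :
    Barrier (cotop (a :: l) f) (N \ {b | b ∈ a :: l}) φ (shift (a :: l) (-δ) x) where
  stable := h.stable.cotop a l
  pos := by
    intro m hm hmN
    have h1 := h.top hm fun b hb => (hmN b hb).1
    rw [← cotop_top]
    have hmem : ∀ b ∈ a :: l, b ∈ N \ {c | c ∈ m} := fun b hb =>
      ⟨hlN b hb, fun hbm => (hmN b hbm).2 hb⟩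
    exact (barrier_step h1.stable h1.pos hl hmem hφ (fun j hj => h1.le j (hmem j hj)) hδ).1
  le := by
    intro c hc
    obtain ⟨h1, h2⟩ := barrier_step h.stable h.pos hl hlN hφ (fun j hj => h.le j (hlN j hj)) hδ
    have h3 := h2 c hc.2
    have h4 := mul_le_mul_of_nonneg_right (h.le c hc.1) h1.le
    have h5 := h.pos.val_pos
    by_contra hcon
    push Not at hcon
    nlinarith [mul_lt_mul_of_pos_right hcon h5]

/-- The product of the operators `cotop` over a list of blocks. -/
def cotops (L : List (List I)) : Module.End ℂ ((I → ℂ) → ℂ) := (L.map cotop).prod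

@[simp] theorem cotops_nil : cotops ([] : List (List I)) = 1 := rfl

theorem cotops_cons_apply (l : List I) (L : List (List I)) (f : (I → ℂ) → ℂ) :
    cotops (l :: L) f = cotop l (cotops L f) := by simp [cotops]

theorem Barrier.cotops {f : (I → ℂ) → ℂ} {N : Set I} {φ δ : ℝ} {x : I → ℝ} (h : Barrier f N φ x)
    (hφ : 0 < φ) {r : ℕ} (hδ : ((r : ℝ) + 1) ^ 2 * φ * δ ≤ (r : ℝ) ^ 2) (L : List (List I))
    (hlen : ∀ l ∈ L, l.length = r + 1) (hnd : L.flatten.Nodup) (hN : ∀ a ∈ L.flatten, a ∈ N) :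
    Barrier (cotops L f) (N \ {b | b ∈ L.flatten}) φ (shift L.flatten (-δ) x) := by
  induction L with
  | nil =>
    have : shift ([] : List (List I)).flatten (-δ) x = x := by ext i; simp [shift]
    rw [this]
    simpa using h
  | cons l L ih =>
    rw [List.flatten_cons, List.nodup_append'] at hnd
    have ih' := ih (fun m hm => hlen m (List.mem_cons_of_mem _ hm)) hnd.2.1
      (fun a ha => hN a (by rw [List.flatten_cons]; exact List.mem_append_right _ ha))
    have hl := hlen l List.mem_cons_self
    obtain ⟨a, m, rfl⟩ := List.exists_cons_of_length_eq_add_one hl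
    have hm : m.length = r := by simpa using hl
    have key := ih'.cotop hnd.1 (δ := δ) (fun b hb =>
      ⟨hN b (by rw [List.flatten_cons]; exact List.mem_append_left _ hb),
        fun hb' => hnd.2.2 hb hb'⟩) hφ (by rw [hm]; exact hδ)
    rw [cotops_cons_apply, List.flatten_cons, shift_append hnd.2.2]
    convert key using 1
    ext b
    simp only [Set.mem_sdiff, Set.mem_ofPred_eq, List.mem_append]
    tauto

theorem hasDerivAt_val_diag [Fintype I] {f : (I → ℂ) → ℂ} (hf : IsMA f) (t : ℝ) :
    HasDerivAt (fun s : ℝ => val f (fun _ => s)) (∑ c, val (pd c f) (fun _ => t)) t := by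
  have e : (fun s : ℝ => val f (fun _ => s))
      = fun s => (diagPoly (fun _ => t) (Finset.univ : Finset I).toList f).eval (s - t) := by
    ext s
    rw [hf.eval_diagPoly _ (Finset.nodup_toList _)]
    congr 1
    ext i
    simp [shift]
  rw [e]
  have h :=
    ((diagPoly (fun _ => t) (Finset.univ : Finset I).toList f).hasDerivAt (t - t)).comp_sub_const
      t t
  have e2 : (derivative (diagPoly (fun _ => t) (Finset.univ : Finset I).toList f)).eval (t - t)
      = ∑ c, val (pd c f) (fun _ => t) := by
    rw [sub_self, ← coeff_zero_eq_eval_zero, coeff_derivative, zero_add, coeff_one_diagPoly,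
      val_dsum, Finset.sum_map_toList]
    simp
  rwa [e2] at h

theorem continuous_val_diag {f : (I → ℂ) → ℂ} (hf : IsMA f) :
    Continuous fun s : ℝ => val f (fun _ => s) := by
  refine Complex.continuous_re.comp (hf.cont.comp (continuous_pi fun i => ?_))
  exact Complex.continuous_ofReal

theorem IsStable.diag_mul_le [Fintype I] {f : (I → ℂ) → ℂ} (hf : IsStable f) (j : I) {θ : ℝ}
    (h : ∀ t, θ ≤ t → 0 < val (MultiAffine.pd j f) (fun _ => t)) {t : ℝ} (ht : θ ≤ t) :
    val f (fun _ => θ) * val (MultiAffine.pd j f) (fun _ => t)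
      ≤ val f (fun _ => t) * val (MultiAffine.pd j f) (fun _ => θ) := by
  have hder : ∀ s, θ ≤ s → HasDerivAt (fun s : ℝ => val f (fun _ => s) /
      val (MultiAffine.pd j f) (fun _ => s)) _ s := fun s hs =>
    (hasDerivAt_val_diag hf.toIsMA s).div (hasDerivAt_val_diag (hf.toIsMA.pd j) s) (h s hs).ne'
  have hmono : MonotoneOn (fun s : ℝ => val f (fun _ => s) /
      val (MultiAffine.pd j f) (fun _ => s)) (Set.Ici θ) := by
    refine monotoneOn_of_deriv_nonneg (convex_Ici θ)
      (fun s hs => (hder s hs).continuousAt.continuousWithinAt)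
      (fun s hs => (hder s (interior_subset hs)).differentiableAt.differentiableWithinAt) ?_
    intro s hs
    rw [(hder s (interior_subset hs)).deriv]
    refine div_nonneg ?_ (sq_nonneg _)
    rw [Finset.sum_mul, Finset.mul_sum, ← Finset.sum_sub_distrib]
    refine Finset.sum_nonneg fun c _ => ?_
    linarith [hf.rayleigh c j (fun _ => s)]
  have := hmono (Set.mem_Ici.2 le_rfl) (Set.mem_Ici.2 ht) ht
  rwa [div_le_div_iff₀ (h θ le_rfl) (h t ht)] at this

theorem top_perm {l m : List I} (h : l.Perm m) : top l = top m := by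
  induction h with
  | nil => rfl
  | cons a _ ih => rw [top_cons, top_cons, ih]
  | swap a b l => simp only [top_cons, ← mul_assoc, (pd_comm a b).eq]
  | trans _ _ ih₁ ih₂ => exact ih₁.trans ih₂

theorem pd_top_erase {j : I} {l : List I} (hj : j ∈ l) (f : (I → ℂ) → ℂ) :
    pd j (top (l.erase j) f) = top l f := by
  rw [← top_cons_apply, top_perm (List.perm_cons_erase hj)]

theorem cotop_eq_sum {l : List I} (hl : l.Nodup) (f : (I → ℂ) → ℂ) :
    cotop l f = (l.map fun j => top (l.erase j) f).sum := by
  induction l with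
  | nil => simp [cotop]
  | cons a l ih =>
    rw [List.nodup_cons] at hl
    rw [cotop_cons_apply, ih hl.2, List.map_cons, List.sum_cons, List.erase_cons_head, add_comm,
      map_list_sum, List.map_map]
    congr 2
    refine List.map_congr_left fun j hj => ?_
    have : a ≠ j := fun h => hl.1 (h ▸ hj)
    rw [Function.comp_apply, List.erase_cons_tail (by simpa using this), top_cons_apply]

theorem val_list_sum {ι : Type*} {J : Type*} (l : List ι) (g : ι → (J → ℂ) → ℂ) (x : J → ℝ) :
    val (l.map g).sum x = (l.map fun j => val (g j) x).sum := by
  induction l with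
  | nil => simp
  | cons a l ih => simp [ih]

theorem Pos.cotop {f : (I → ℂ) → ℂ} {N : Set I} {x : I → ℝ} (h : Pos f N x) {l : List I}
    (hne : l ≠ []) (hl : l.Nodup) (hlN : ∀ a ∈ l, a ∈ N) :
    Pos (cotop l f) (N \ {a | a ∈ l}) x := by
  intro m hm hmN
  rw [← cotop_top, cotop_eq_sum hl, val_list_sum]
  refine List.sum_pos _ ?_ (by simpa using hne)
  intro y hy
  obtain ⟨j, hj, rfl⟩ := List.mem_map.1 hy
  rw [← Module.End.mul_apply, ← top_append]
  refine h _ (List.nodup_append'.2 ⟨hl.erase j, hm,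
    fun a ha hb => (hmN a hb).2 (List.mem_of_mem_erase ha)⟩) ?_
  intro b hb
  rcases List.mem_append.1 hb with hb | hb
  · exact hlN b (List.mem_of_mem_erase hb)
  · exact (hmN b hb).1

theorem IsStable.exists_erase_pos [Fintype I] {f : (I → ℂ) → ℂ} (hf : IsStable f) {l : List I}
    (hl : l.Nodup) {b μ : ℝ} (hpos : ∀ t, b ≤ t → Pos f {a | a ∈ l} (fun _ => t))
    (h : ∀ t, μ ≤ t → 0 < val (MultiAffine.cotop l f) (fun _ => t)) :
    ∃ j ∈ l, ∀ t, μ ≤ t → 0 < val (MultiAffine.top (l.erase j) f) (fun _ => t) := by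
  have hsum : ∀ t, μ ≤ t → ∃ j ∈ l, 0 < val (MultiAffine.top (l.erase j) f) (fun _ => t) := by
    intro t ht
    have h1 := h t ht
    rw [cotop_eq_sum hl, val_list_sum] at h1
    by_contra hcon
    push Not at hcon
    refine absurd h1 (not_lt.2 ((List.sum_le_card_nsmul _ 0 fun y hy => ?_).trans (by simp)))
    obtain ⟨j, hj, rfl⟩ := List.mem_map.1 hy
    exact hcon j hj
  have hb : ∀ t, b ≤ t → 0 < val (MultiAffine.top l f) (fun _ => t) := fun t ht =>
    hpos t ht l hl fun a ha => ha
  have hmono : ∀ j ∈ l, ∀ θ, (∀ t, θ ≤ t → 0 < val (MultiAffine.top l f) (fun _ => t)) →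
      ∀ t, θ ≤ t → val (MultiAffine.top (l.erase j) f) (fun _ => θ) *
        val (MultiAffine.top l f) (fun _ => t) ≤ val (MultiAffine.top (l.erase j) f) (fun _ => t) *
          val (MultiAffine.top l f) (fun _ => θ) := by
    intro j hj θ hθ t ht
    have := (hf.top (l.erase j)).diag_mul_le j (θ := θ)
    rw [pd_top_erase hj] at this
    exact this hθ ht
  have htop : ∀ t, μ ≤ t → 0 < val (MultiAffine.top l f) (fun _ => t) := by
    by_contra hcon
    push Not at hcon
    obtain ⟨t₀, ht₀, hneg⟩ := hcon
    have hc := continuous_val_diag (hf.toIsMA.top l)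
    have hcomp : IsCompact (Set.Icc μ b ∩ {t | val (MultiAffine.top l f) (fun _ => t) ≤ 0}) :=
      isCompact_Icc.inter_right (isClosed_le hc continuous_const)
    have hlt : ∀ t, val (MultiAffine.top l f) (fun _ => t) ≤ 0 → t < b := fun t ht => by
      by_contra hc
      exact absurd (hb t (not_lt.1 hc)) (not_lt.2 ht)
    obtain ⟨θ, ⟨⟨hθ1, hθ2⟩, hθ3⟩, hθ4⟩ := hcomp.exists_isGreatest
      ⟨t₀, ⟨ht₀, (hlt t₀ hneg).le⟩, hneg⟩
    have hθ3' : val (MultiAffine.top l f) (fun _ => θ) ≤ 0 := hθ3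
    have hgt : ∀ t, θ < t → 0 < val (MultiAffine.top l f) (fun _ => t) := by
      intro t ht
      by_contra hc
      have hc' := not_lt.1 hc
      exact absurd (hθ4 ⟨⟨hθ1.trans ht.le, (hlt t hc').le⟩, hc'⟩) (not_le.2 ht)
    obtain ⟨j, hj, hjpos⟩ := hsum θ hθ1
    have hθb : θ < b := hlt θ hθ3'
    have hlim : val (MultiAffine.top (l.erase j) f) (fun _ => θ) *
        val (MultiAffine.top l f) (fun _ => b) ≤ val (MultiAffine.top (l.erase j) f) (fun _ => b) *
          val (MultiAffine.top l f) (fun _ => θ) := by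
      have hcj := continuous_val_diag (hf.toIsMA.top (l.erase j))
      refine le_of_tendsto_of_tendsto
        (((hcj.mul continuous_const).tendsto θ).mono_left
          (nhdsWithin_le_nhds (s := Set.Ioi θ)))
        (((continuous_const.mul hc).tendsto θ).mono_left
          (nhdsWithin_le_nhds (s := Set.Ioi θ))) ?_
      filter_upwards [Ioo_mem_nhdsGT hθb] with s hs
      exact hmono j hj s (fun t ht => hgt t (hs.1.trans_le ht)) b hs.2.le
    have hbj : 0 < val (MultiAffine.top (l.erase j) f) (fun _ => b) :=
      hpos b le_rfl _ (hl.erase j) fun a ha => List.mem_of_mem_erase ha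
    nlinarith [mul_pos hjpos (hb b le_rfl)]
  obtain ⟨j, hj, hjpos⟩ := hsum μ le_rfl
  refine ⟨j, hj, fun t ht => ?_⟩
  have h1 := hmono j hj μ htop t ht
  have h2 := mul_pos hjpos (htop t ht)
  by_contra hcon
  exact absurd (h2.trans_le h1)
    (not_lt.2 (mul_nonpos_of_nonpos_of_nonneg (not_lt.1 hcon) (htop μ le_rfl).le))

theorem IsStable.cotops {f : (I → ℂ) → ℂ} (hf : IsStable f) {L : List (List I)}
    (hL : ∀ l ∈ L, l ≠ []) : IsStable (cotops L f) := by
  induction L with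
  | nil => simpa
  | cons l L ih =>
    rw [cotops_cons_apply]
    obtain ⟨a, m, rfl⟩ := List.exists_cons_of_ne_nil (hL l List.mem_cons_self)
    exact (ih fun m hm => hL m (List.mem_cons_of_mem _ hm)).cotop a m

theorem Pos.cotops {f : (I → ℂ) → ℂ} {N : Set I} {x : I → ℝ} (h : Pos f N x) {L : List (List I)}
    (hL : ∀ l ∈ L, l ≠ []) (hnd : L.flatten.Nodup) (hN : ∀ a ∈ L.flatten, a ∈ N) :
    Pos (cotops L f) (N \ {a | a ∈ L.flatten}) x := by
  induction L with
  | nil => simpa using h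
  | cons l L ih =>
    rw [List.flatten_cons, List.nodup_append'] at hnd
    have ih' := ih (fun m hm => hL m (List.mem_cons_of_mem _ hm)) hnd.2.1
      (fun a ha => hN a (by rw [List.flatten_cons]; exact List.mem_append_right _ ha))
    rw [cotops_cons_apply]
    refine (ih'.cotop (hL l List.mem_cons_self) hnd.1 fun b hb =>
      ⟨hN b (by rw [List.flatten_cons]; exact List.mem_append_left _ hb),
        fun hb' => hnd.2.2 hb hb'⟩).mono ?_
    intro b
    simp only [Set.mem_sdiff, Set.mem_ofPred_eq, List.flatten_cons, List.mem_append]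
    tauto

theorem cotops_top (L : List (List I)) (m : List I) (f : (I → ℂ) → ℂ) :
    cotops L (top m f) = top m (cotops L f) := by
  induction L with
  | nil => simp
  | cons l L ih => rw [cotops_cons_apply, cotops_cons_apply, ih, cotop_top]

/-- Positivity of the mixed derivative on a half-line passes to one of its constituents. -/
theorem IsStable.exists_top_pos [Fintype I] {f : (I → ℂ) → ℂ} (hf : IsStable f)
    {L : List (List I)} (hL : ∀ l ∈ L, l ≠ []) (hnd : L.flatten.Nodup) {N : Set I}
    (hN : ∀ a ∈ L.flatten, a ∈ N) {b μ : ℝ} (hpos : ∀ t, b ≤ t → Pos f N (fun _ => t))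
    (h : ∀ t, μ ≤ t → 0 < val (MultiAffine.cotops L f) (fun _ => t)) :
    ∃ M : List I, M.Nodup ∧ (∀ a ∈ M, a ∈ L.flatten) ∧ (∀ l ∈ L, ∃ j ∈ l, j ∉ M) ∧
      ∀ t, μ ≤ t → 0 < val (MultiAffine.top M f) (fun _ => t) := by
  induction L generalizing f N with
  | nil => exact ⟨[], by simp, by simp, by simp, by simpa using h⟩
  | cons l L ih =>
    rw [List.flatten_cons, List.nodup_append'] at hnd
    have hL' := fun m hm => hL m (List.mem_cons_of_mem _ hm)
    have hN1 : ∀ a ∈ L.flatten, a ∈ N := fun a ha =>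
      hN a (by rw [List.flatten_cons]; exact List.mem_append_right _ ha)
    have hN2 : ∀ a ∈ l, a ∈ N := fun a ha =>
      hN a (by rw [List.flatten_cons]; exact List.mem_append_left _ ha)
    obtain ⟨j, hj, hjpos⟩ := (hf.cotops hL').exists_erase_pos hnd.1 (b := b) (μ := μ)
      (fun t ht => ((hpos t ht).cotops hL' hnd.2.1 hN1).mono fun a ha =>
        ⟨hN2 a ha, fun hb => hnd.2.2 ha hb⟩)
      (fun t ht => by have := h t ht; rwa [cotops_cons_apply] at this)
    have hsub : ∀ a ∈ l.erase j, a ∈ l := fun a ha => List.mem_of_mem_erase ha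
    obtain ⟨M, hM1, hM2, hM3, hM4⟩ := ih (hf.top (l.erase j)) hL' hnd.2.1
      (N := N \ {a | a ∈ l.erase j})
      (fun a ha => ⟨hN1 a ha, fun hb => hnd.2.2 (hsub a hb) ha⟩)
      (fun t ht => (hpos t ht).top (hnd.1.erase j) fun a ha => hN2 a (hsub a ha))
      (fun t ht => by rw [cotops_top]; exact hjpos t ht)
    refine ⟨M ++ l.erase j, ?_, ?_, ?_, ?_⟩
    · exact List.nodup_append'.2 ⟨hM1, hnd.1.erase j, fun a ha hb => hnd.2.2 (hsub a hb) (hM2 a ha)⟩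
    · intro a ha
      rw [List.flatten_cons]
      rcases List.mem_append.1 ha with ha | ha
      · exact List.mem_append_right _ (hM2 a ha)
      · exact List.mem_append_left _ (hsub a ha)
    · intro m hm
      rcases List.mem_cons.1 hm with rfl | hm
      · refine ⟨j, hj, fun hmem => ?_⟩
        rcases List.mem_append.1 hmem with hmem | hmem
        · exact hnd.2.2 hj (hM2 j hmem)
        · exact hnd.1.not_mem_erase hmem
      · obtain ⟨k, hk, hkM⟩ := hM3 m hm
        refine ⟨k, hk, fun hmem => ?_⟩
        rcases List.mem_append.1 hmem with hmem | hmem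
        · exact hkM hmem
        · exact hnd.2.2 (hsub k hmem) (List.mem_flatten.2 ⟨m, hm, hk⟩)
    · intro t ht
      rw [top_append, Module.End.mul_apply]
      exact hM4 t ht

end MultiAffine

/-- The squared Euclidean norm. -/
def nsq {n : ℕ} (v : Fin n → ℂ) : ℝ := ∑ i, Complex.normSq (v i)

theorem nsq_nonneg {n : ℕ} (v : Fin n → ℂ) : 0 ≤ nsq v :=
  Finset.sum_nonneg fun _ _ => Complex.normSq_nonneg _

theorem nsq_eq_zero {n : ℕ} {v : Fin n → ℂ} : nsq v = 0 ↔ v = 0 := by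
  rw [nsq, Finset.sum_eq_zero_iff_of_nonneg fun _ _ => Complex.normSq_nonneg _]
  simp [funext_iff]

theorem star_dotProduct_self {n : ℕ} (v : Fin n → ℂ) : star v ⬝ᵥ v = (nsq v : ℂ) := by
  simp [dotProduct, nsq, Complex.normSq_eq_conj_mul_self]

theorem energySq_one {n : ℕ} (v : Fin n → ℂ) : energySq 1 v = nsq v := by
  rw [energySq, one_mulVec, star_dotProduct_self, Complex.ofReal_re]

theorem Matrix.IsHermitian.dotProduct_mulVec_eq {n : ℕ} {B : Matrix (Fin n) (Fin n) ℂ}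
    (hB : B.IsHermitian) (u v : Fin n → ℂ) : star u ⬝ᵥ (B *ᵥ v) = star (B *ᵥ u) ⬝ᵥ v := by
  rw [star_mulVec, hB.eq, dotProduct_mulVec]

theorem Matrix.IsHermitian.star_dotProduct_mulVec {n : ℕ} {B : Matrix (Fin n) (Fin n) ℂ}
    (hB : B.IsHermitian) (u v : Fin n → ℂ) :
    starRingEnd ℂ (star u ⬝ᵥ (B *ᵥ v)) = star v ⬝ᵥ (B *ᵥ u) := by
  rw [hB.dotProduct_mulVec_eq v u, dotProduct_comm, starRingEnd_apply,
    ← star_dotProduct_star, star_star, dotProduct_comm]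

theorem Matrix.IsHermitian.coe_energySq {n : ℕ} {B : Matrix (Fin n) (Fin n) ℂ}
    (hB : B.IsHermitian) (v : Fin n → ℂ) : (energySq B v : ℂ) = star v ⬝ᵥ (B *ᵥ v) :=
  Complex.conj_eq_iff_re.1 (hB.star_dotProduct_mulVec v v)

theorem energySq_nonneg {n : ℕ} {B : Matrix (Fin n) (Fin n) ℂ} (hB : B.PosSemidef)
    (v : Fin n → ℂ) : 0 ≤ energySq B v :=
  (Complex.nonneg_iff.1 (hB.dotProduct_mulVec_nonneg v)).1

theorem posSemidef_of_energySq_nonneg {n : ℕ} {B : Matrix (Fin n) (Fin n) ℂ} (hB : B.IsHermitian)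
    (h : ∀ v, 0 ≤ energySq B v) : B.PosSemidef :=
  .of_dotProduct_mulVec_nonneg hB fun v => by
    rw [← hB.coe_energySq]; exact_mod_cast h v

theorem Matrix.IsHermitian.energySq_add_smul {n : ℕ} {B : Matrix (Fin n) (Fin n) ℂ}
    (hB : B.IsHermitian) (u v : Fin n → ℂ) (c : ℂ) :
    energySq B (v + c • u) = energySq B v + 2 * (starRingEnd ℂ c * (star u ⬝ᵥ (B *ᵥ v))).re
      + Complex.normSq c * energySq B u := by
  have h := hB.star_dotProduct_mulVec u v
  simp only [energySq, mulVec_add, mulVec_smul, star_add, star_smul, add_dotProduct,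
    dotProduct_add, smul_dotProduct, dotProduct_smul, ← h, smul_eq_mul]
  simp [Complex.normSq_apply]
  ring

theorem energySq_cauchy_schwarz {n : ℕ} {B : Matrix (Fin n) (Fin n) ℂ} (hB : B.PosSemidef)
    (u v : Fin n → ℂ) :
    Complex.normSq (star u ⬝ᵥ (B *ᵥ v)) ≤ energySq B u * energySq B v := by
  set α := star u ⬝ᵥ (B *ᵥ v) with hα
  have hN := Complex.normSq_nonneg α
  have key : ∀ t : ℝ, 0 ≤ Complex.normSq α * energySq B u * (t * t)
      + (-2 * Complex.normSq α) * t + energySq B v := by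
    intro t
    have h := energySq_nonneg hB (v + (-(t : ℂ) * α) • u)
    rw [hB.1.energySq_add_smul, ← hα] at h
    simp only [map_mul, map_neg, Complex.conj_ofReal, Complex.normSq_neg,
      Complex.normSq_ofReal] at h
    have e : (-(t : ℂ) * starRingEnd ℂ α * α).re = -t * Complex.normSq α := by
      rw [mul_assoc, ← Complex.normSq_eq_conj_mul_self]; simp
    rw [e] at h
    linarith
  have hd := discrim_le_zero key
  rw [discrim] at hd
  rcases hN.eq_or_lt with h0 | h0
  · rw [← h0]; exact mul_nonneg (energySq_nonneg hB u) (energySq_nonneg hB v)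
  · by_contra hcon
    push Not at hcon
    nlinarith [mul_lt_mul_of_pos_left hcon h0]

theorem nsq_mulVec_le {n : ℕ} {B : Matrix (Fin n) (Fin n) ℂ} (hB : B.PosSemidef) {lam : ℝ}
    (hle : ∀ v, energySq B v ≤ lam * nsq v) (v : Fin n → ℂ) :
    nsq (B *ᵥ v) ≤ lam * energySq B v := by
  have h := energySq_cauchy_schwarz hB (B *ᵥ v) v
  rw [star_dotProduct_self, Complex.normSq_ofReal] at h
  have h1 := hle (B *ᵥ v)
  have h2 := energySq_nonneg hB v
  have h3 := nsq_nonneg (B *ᵥ v)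
  rcases h3.eq_or_lt with h0 | h0
  · rw [← h0]
    rcases (nsq_nonneg v).eq_or_lt with h4 | h4
    · have : v = 0 := nsq_eq_zero.1 h4.symm
      simp [this, energySq]
    · have h5 := hle v
      have : 0 ≤ lam := by
        by_contra hc
        push Not at hc
        nlinarith [mul_pos_of_neg_of_neg hc (neg_lt_zero.2 h4)]
      positivity
  · by_contra hcon
    push Not at hcon
    have := mul_le_mul_of_nonneg_right h1 h2
    nlinarith [mul_lt_mul_of_pos_left hcon h0]

/-- A Hermitian matrix violating a bound on its quadratic form has a large eigenvalue. -/
theorem Matrix.IsHermitian.exists_eigenvector {n : ℕ} {B : Matrix (Fin n) (Fin n) ℂ}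
    (hB : B.IsHermitian) {c : ℝ} {v : Fin n → ℂ} (hv : c * nsq v < energySq B v) :
    ∃ μ : ℝ, c < μ ∧ ∃ w ≠ 0, B *ᵥ w = (μ : ℂ) • w := by
  have hA : ((c : ℂ) • (1 : Matrix (Fin n) (Fin n) ℂ) - B).IsHermitian := by
    refine IsHermitian.sub ?_ hB
    simp [IsHermitian, conjTranspose_smul]
  have hnot : ¬ ∀ i, 0 ≤ hA.eigenvalues i := by
    intro hall
    have hp := hA.posSemidef_iff_eigenvalues_nonneg.2 hall
    have := energySq_nonneg hp v
    rw [energySq, sub_mulVec, smul_mulVec, one_mulVec, dotProduct_sub, dotProduct_smul,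
      star_dotProduct_self] at this
    rw [energySq] at hv
    simp at this
    linarith
  push Not at hnot
  obtain ⟨i, hi⟩ := hnot
  refine ⟨c - hA.eigenvalues i, by linarith, (hA.eigenvectorBasis i).ofLp, ?_, ?_⟩
  · intro h0
    have h1 := hA.eigenvectorBasis.orthonormal.ne_zero i
    exact h1 (by ext k; simpa using congrFun h0 k)
  · have h1 := hA.mulVec_eigenvectorBasis i
    rw [sub_mulVec, smul_mulVec, one_mulVec] at h1
    have h2 : B *ᵥ (hA.eigenvectorBasis i).ofLp
      = (c : ℂ) • (hA.eigenvectorBasis i).ofLp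
        - hA.eigenvalues i • (hA.eigenvectorBasis i).ofLp := by
      rw [← h1]; abel
    rw [h2]
    ext k
    simp
    ring

namespace MultiAffine

variable {n r : ℕ}

/-- The matrix `diagonal z - B` for one color, with the rows marked in a list replaced by those of
the identity. -/
noncomputable def rowMat (B : Matrix (Fin n) (Fin n) ℂ) (l : List (Fin n × Fin r))
    (z : Fin n × Fin r → ℂ) (j : Fin r) : Matrix (Fin n) (Fin n) ℂ :=
  Matrix.of fun i => if (i, j) ∈ l then Pi.single i 1 else Pi.single i (z (i, j)) - B i

/-- The product over the colors of the determinants of `rowMat`. -/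
noncomputable def colorDet (B : Matrix (Fin n) (Fin n) ℂ) (l : List (Fin n × Fin r))
    (z : Fin n × Fin r → ℂ) : ℂ := ∏ j, (rowMat B l z j).det

theorem colorDet_update (B : Matrix (Fin n) (Fin n) ℂ) {l : List (Fin n × Fin r)}
    {a : Fin n × Fin r} (ha : a ∉ l) (z : Fin n × Fin r → ℂ) (t : ℂ) :
    colorDet B l (Function.update z a t)
      = colorDet B l (Function.update z a 0) + t * colorDet B (a :: l) z := by
  obtain ⟨i, j⟩ := a
  have hoff : ∀ j' ∈ Finset.univ.erase j, ∀ t : ℂ,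
      rowMat B l (Function.update z (i, j) t) j' = rowMat B ((i, j) :: l) z j' := by
    intro j' hj' t
    have hne := Finset.ne_of_mem_erase hj'
    ext k m
    simp [rowMat, hne]
  have hrow : ∀ t : ℂ, rowMat B l (Function.update z (i, j) t) j
      = (rowMat B l z j).updateRow i (t • Pi.single i 1 + -B i) := by
    intro t
    ext k m
    by_cases hk : k = i
    · subst hk
      by_cases hm : m = k
      · subst hm; simp [rowMat, ha, sub_eq_add_neg]
      · simp [rowMat, ha, hm]
    · simp [rowMat, hk]
  have hrow1 : rowMat B ((i, j) :: l) z j = (rowMat B l z j).updateRow i (Pi.single i 1) := by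
    ext k m
    by_cases hk : k = i
    · subst hk; simp [rowMat]
    · simp [rowMat, hk]
  have hdet : ∀ t : ℂ, (rowMat B l (Function.update z (i, j) t) j).det
      = t * (rowMat B ((i, j) :: l) z j).det + ((rowMat B l z j).updateRow i (-B i)).det := by
    intro t
    rw [hrow, hrow1, det_updateRow_add, det_updateRow_smul]
  have hP : ∀ t : ℂ, colorDet B l (Function.update z (i, j) t)
      = (t * (rowMat B ((i, j) :: l) z j).det + ((rowMat B l z j).updateRow i (-B i)).det)
        * ∏ j' ∈ Finset.univ.erase j, (rowMat B ((i, j) :: l) z j').det := by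
    intro t
    rw [colorDet, ← Finset.mul_prod_erase _ _ (Finset.mem_univ j), hdet]
    congr 1
    exact Finset.prod_congr rfl fun j' hj' => by rw [hoff j' hj']
  rw [hP, hP, colorDet, ← Finset.mul_prod_erase _ _ (Finset.mem_univ j)]
  ring

theorem pd_colorDet (B : Matrix (Fin n) (Fin n) ℂ) {l : List (Fin n × Fin r)}
    {a : Fin n × Fin r} (ha : a ∉ l) : pd a (colorDet B l) = colorDet B (a :: l) := by
  ext z
  rw [pd_apply, colorDet_update B ha z 1]
  ring

theorem top_colorDet (B : Matrix (Fin n) (Fin n) ℂ) {l : List (Fin n × Fin r)} (hl : l.Nodup) :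
    top l (colorDet B []) = colorDet B l := by
  induction l with
  | nil => simp
  | cons a l ih =>
    rw [List.nodup_cons] at hl
    rw [top_cons_apply, ih hl.2, pd_colorDet B hl.1]

theorem top_eq_zero_of_not_nodup {I : Type*} [DecidableEq I] {l : List I} (hl : ¬ l.Nodup) :
    top l = 0 := by
  induction l with
  | nil => simp at hl
  | cons a l ih =>
    rw [top_cons]
    by_cases ha : a ∈ l
    · obtain ⟨l₁, l₂, rfl⟩ := List.append_of_mem ha
      rw [top_append, top_cons, ← mul_assoc, (pd_top a l₁).eq, mul_assoc, ← mul_assoc (pd a),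
        pd_mul_self, zero_mul, mul_zero]
    · rw [ih fun h => hl (List.nodup_cons.2 ⟨ha, h⟩), mul_zero]

theorem continuous_colorDet {X : Type*} [TopologicalSpace X] (l : List (Fin n × Fin r))
    {M : X → Matrix (Fin n) (Fin n) ℂ} {z : X → Fin n × Fin r → ℂ} (hM : Continuous M)
    (hz : Continuous z) : Continuous fun x => colorDet (M x) l (z x) := by
  refine continuous_finsetProd _ fun j _ => Continuous.matrix_det ?_
  refine continuous_matrix fun i k => ?_
  have hMik : Continuous fun x => M x i k := hM.matrix_elem i k
  have hzij : Continuous fun x => z x (i, j) := (continuous_apply (i, j)).comp hz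
  by_cases h : (i, j) ∈ l
  · simp only [rowMat, of_apply, h, if_true]; exact continuous_const
  · simp only [rowMat, of_apply, h, if_false, Pi.sub_apply, Pi.single_apply]
    by_cases hk : k = i
    · subst hk; simp only [if_true]; exact hzij.sub hMik
    · simp only [hk, if_false]; exact continuous_const.sub hMik

theorem isMA_colorDet {B : Matrix (Fin n) (Fin n) ℂ} (hB : B.IsHermitian) :
    IsMA (colorDet (r := r) B []) where
  aff a z := by
    conv_lhs => rw [← Function.update_eq_self a z]
    rw [colorDet_update B (by simp), pd_colorDet B (by simp)]
  cont := continuous_colorDet [] continuous_const continuous_id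
  real z := by
    simp only [colorDet, map_prod]
    refine Finset.prod_congr rfl fun j _ => ?_
    rw [starRingEnd_apply, ← det_conjTranspose]
    congr 1
    ext i k
    have := congrFun (congrFun hB i) k
    rw [conjTranspose_apply] at this
    by_cases h : i = k
    · subst h; simp [rowMat, conjTranspose_apply, this]
    · simp [rowMat, conjTranspose_apply, this, h, Ne.symm h]

theorem rowMat_mulVec (B : Matrix (Fin n) (Fin n) ℂ) (l : List (Fin n × Fin r))
    (z : Fin n × Fin r → ℂ) (j : Fin r) (v : Fin n → ℂ) (i : Fin n) :
    (rowMat B l z j *ᵥ v) i = if (i, j) ∈ l then v i else z (i, j) * v i - (B *ᵥ v) i := by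
  by_cases h : (i, j) ∈ l
  · simp [rowMat, mulVec, h]
  · have e : (rowMat B l z j) i = Pi.single i (z (i, j)) - B i := if_neg h
    rw [if_neg h]
    change (rowMat B l z j) i ⬝ᵥ v = _
    rw [e, sub_dotProduct, single_dotProduct]
    rfl

theorem exists_of_colorDet_eq_zero {B : Matrix (Fin n) (Fin n) ℂ} (hB : B.IsHermitian)
    {l : List (Fin n × Fin r)} {z : Fin n × Fin r → ℂ} (h : colorDet B l z = 0) :
    ∃ (j : Fin r) (v : Fin n → ℂ), v ≠ 0 ∧
      ∑ i, z (i, j) * (Complex.normSq (v i) : ℂ) = (energySq B v : ℂ) := by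
  obtain ⟨j, -, hj⟩ := Finset.prod_eq_zero_iff.1 h
  obtain ⟨v, hv, hv0⟩ := exists_mulVec_eq_zero_iff.2 hj
  refine ⟨j, v, hv, ?_⟩
  rw [hB.coe_energySq, dotProduct]
  refine Finset.sum_congr rfl fun i _ => ?_
  have h1 := congrFun hv0 i
  rw [rowMat_mulVec] at h1
  split_ifs at h1 with hi
  · have h2 : v i = 0 := h1
    simp [h2]
  · have h2 : (B *ᵥ v) i = z (i, j) * v i := by
      rw [Pi.zero_apply, sub_eq_zero] at h1; exact h1.symm
    rw [h2, Complex.normSq_eq_conj_mul_self, Pi.star_apply, starRingEnd_apply]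
    ring

theorem colorDet_ne_zero_of_im_pos {B : Matrix (Fin n) (Fin n) ℂ} (hB : B.IsHermitian)
    (l : List (Fin n × Fin r)) {z : Fin n × Fin r → ℂ} (hz : ∀ a, 0 < (z a).im) :
    colorDet B l z ≠ 0 := by
  intro h
  obtain ⟨j, v, hv, e⟩ := exists_of_colorDet_eq_zero hB h
  have e' := congrArg Complex.im e
  rw [Complex.ofReal_im, Complex.im_sum, Finset.sum_eq_zero_iff_of_nonneg] at e'
  · apply hv
    ext i
    have := e' i (Finset.mem_univ i)
    rw [Complex.im_mul_ofReal] at this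
    simpa [(hz (i, j)).ne'] using this
  · intro i _
    rw [Complex.im_mul_ofReal]
    exact mul_nonneg (hz _).le (Complex.normSq_nonneg _)

theorem colorDet_ne_zero_of_lt {B : Matrix (Fin n) (Fin n) ℂ} (hB : B.IsHermitian)
    (l : List (Fin n × Fin r)) {t : ℝ} (ht : ∀ v ≠ 0, energySq B v < t * nsq v) :
    colorDet B l (fun _ => (t : ℂ)) ≠ 0 := by
  intro h
  obtain ⟨j, v, hv, e⟩ := exists_of_colorDet_eq_zero hB h
  have := ht v hv
  rw [← Finset.mul_sum] at e
  have e' : t * nsq v = energySq B v := by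
    rw [nsq]; exact_mod_cast e
  exact this.ne e'.symm

theorem isStable_colorDet {B : Matrix (Fin n) (Fin n) ℂ} (hB : B.IsHermitian) :
    IsStable (colorDet (r := r) B []) where
  toIsMA := isMA_colorDet hB
  zero l z hz h a := by
    by_cases hl : l.Nodup
    · rw [top_colorDet B hl] at h
      exact absurd h (colorDet_ne_zero_of_im_pos hB l hz)
    · rw [top_eq_zero_of_not_nodup hl]
      simp

theorem val_colorDet_pos {B : Matrix (Fin n) (Fin n) ℂ} (hB : B.IsHermitian)
    {l : List (Fin n × Fin r)} (hl : l.Nodup) {t : ℝ} (ht0 : 0 < t)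
    (ht : ∀ v ≠ 0, energySq B v < t * nsq v) : 0 < val (colorDet B l) (fun _ => t) := by
  have hc : Continuous fun s : ℝ => val (colorDet ((s : ℂ) • B) l) (fun _ => t) := by
    have hM : Continuous fun s : ℝ => (s : ℂ) • B :=
      Complex.continuous_ofReal.smul continuous_const
    exact Complex.continuous_re.comp (continuous_colorDet l hM continuous_const)
  have hH : ∀ s : ℝ, ((s : ℂ) • B).IsHermitian := by
    intro s
    rw [IsHermitian, conjTranspose_smul, hB.eq]
    simp
  have hne : ∀ s ∈ Set.Icc (0 : ℝ) 1, val (colorDet ((s : ℂ) • B) l) (fun _ => t) ≠ 0 := by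
    intro s hs h0
    have h1 := ((isMA_colorDet (r := r) (hH s)).top l).ofReal_val (fun _ => t)
    rw [top_colorDet _ hl, h0] at h1
    refine colorDet_ne_zero_of_lt (hH s) l (t := t) ?_ h1.symm
    intro v hv
    have h2 : energySq ((s : ℂ) • B) v = s * energySq B v := by
      rw [energySq, smul_mulVec, dotProduct_smul, smul_eq_mul, Complex.re_ofReal_mul, energySq]
    have h3 : 0 < nsq v := (nsq_nonneg v).lt_of_ne fun h => hv (nsq_eq_zero.1 h.symm)
    have h4 := ht v hv
    rw [h2]
    rcases hs.1.eq_or_lt with h5 | h5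
    · rw [← h5, zero_mul]; positivity
    · calc s * energySq B v < s * (t * nsq v) := by gcongr
        _ ≤ 1 * (t * nsq v) := by
          have := hs.2
          gcongr
        _ = _ := one_mul _
  have h0 : 0 < val (colorDet (((0 : ℝ) : ℂ) • B) l) (fun _ => t) := by
    have e : colorDet (((0 : ℝ) : ℂ) • B) l (cplx fun _ => t)
        = ((∏ j, ∏ i, if (i, j) ∈ l then 1 else t : ℝ) : ℂ) := by
      rw [colorDet, Complex.ofReal_prod]
      refine Finset.prod_congr rfl fun j _ => ?_
      have : rowMat (((0 : ℝ) : ℂ) • B) l (cplx fun _ => t) j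
          = diagonal fun i => ((if (i, j) ∈ l then 1 else t : ℝ) : ℂ) := by
        ext i k
        by_cases hik : i = k
        · subst hik
          by_cases h : (i, j) ∈ l <;> simp [rowMat, h, cplx]
        · by_cases h : (i, j) ∈ l <;> simp [rowMat, h, hik, Ne.symm hik]
      rw [this, det_diagonal, Complex.ofReal_prod]
    rw [val, e, Complex.ofReal_re]
    refine Finset.prod_pos fun j _ => Finset.prod_pos fun i _ => ?_
    split_ifs <;> linarith
  have h1 : 0 < val (colorDet (((1 : ℝ) : ℂ) • B) l) (fun _ => t) := by
    by_contra hcon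
    obtain ⟨s, hs, hs0⟩ := intermediate_value_Icc' (zero_le_one' ℝ) hc.continuousOn
      ⟨not_lt.1 hcon, h0.le⟩
    exact hne s hs hs0
  simpa using h1

end MultiAffine

namespace MultiAffine

variable {n : ℕ}

theorem rowMat_nil_const {r : ℕ} (B : Matrix (Fin n) (Fin n) ℂ) (t : ℝ) (j : Fin r) :
    rowMat B [] (cplx fun _ => t) j = (t : ℂ) • (1 : Matrix (Fin n) (Fin n) ℂ) - B := by
  ext i k
  by_cases h : i = k
  · subst h; simp [rowMat, cplx]
  · simp [rowMat, cplx, h, Ne.symm h]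

theorem rowMat_singleton_const {r : ℕ} (B : Matrix (Fin n) (Fin n) ℂ) (t : ℝ) (i : Fin n)
    (j j' : Fin r) : rowMat B [(i, j)] (cplx fun _ => t) j'
      = if j' = j then ((t : ℂ) • (1 : Matrix (Fin n) (Fin n) ℂ) - B).updateRow i (Pi.single i 1)
        else (t : ℂ) • (1 : Matrix (Fin n) (Fin n) ℂ) - B := by
  rw [← rowMat_nil_const B t j']
  by_cases hj : j' = j
  · rw [if_pos hj]
    ext k m
    by_cases hk : k = i
    · subst hk; simp [rowMat, hj]
    · simp [rowMat, hk]
  · rw [if_neg hj]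
    ext k m
    simp [rowMat, hj]

theorem energySq_lt {B : Matrix (Fin n) (Fin n) ℂ} {lam t : ℝ}
    (hle : ∀ v, energySq B v ≤ lam * nsq v) (ht : lam < t) (v : Fin n → ℂ) (hv : v ≠ 0) :
    energySq B v < t * nsq v := by
  have h3 : 0 < nsq v := (nsq_nonneg v).lt_of_ne fun h => hv (nsq_eq_zero.1 h.symm)
  nlinarith [hle v]

theorem exists_det_eq {B : Matrix (Fin n) (Fin n) ℂ} (hB : B.IsHermitian) {lam t : ℝ}
    (hle : ∀ v, energySq B v ≤ lam * nsq v) (ht : lam < t) (ht0 : 0 < t) :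
    ∃ d : ℝ, 0 < d ∧ ((t : ℂ) • (1 : Matrix (Fin n) (Fin n) ℂ) - B).det = d := by
  refine ⟨_, val_colorDet_pos (r := 1) hB List.nodup_nil ht0 (energySq_lt hle ht), ?_⟩
  rw [(isMA_colorDet hB).ofReal_val, colorDet]
  simp [rowMat_nil_const]

theorem exists_det_updateRow_eq {B : Matrix (Fin n) (Fin n) ℂ} (hB : B.IsHermitian) {lam t : ℝ}
    (hle : ∀ v, energySq B v ≤ lam * nsq v) (ht : lam < t) (ht0 : 0 < t) (i : Fin n) :
    ∃ e : ℝ, 0 < e ∧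
      (((t : ℂ) • (1 : Matrix (Fin n) (Fin n) ℂ) - B).updateRow i (Pi.single i 1)).det = e := by
  refine ⟨_, val_colorDet_pos (r := 1) hB (List.nodup_singleton (i, 0)) ht0 (energySq_lt hle ht),
    ?_⟩
  have h := ((isMA_colorDet (r := 1) hB).top [(i, 0)]).ofReal_val fun _ => t
  rw [top_colorDet B (List.nodup_singleton _)] at h
  rw [h, colorDet]
  simp [rowMat_singleton_const]

theorem det_updateRow_le {B : Matrix (Fin n) (Fin n) ℂ} (hB : B.PosSemidef) {lam t d e : ℝ}
    (hle : ∀ v, energySq B v ≤ lam * nsq v) (ht : lam < t) (ht0 : 0 < t) {i : Fin n}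
    (hi : B i i = 1) (hd0 : 0 < d)
    (hd : ((t : ℂ) • (1 : Matrix (Fin n) (Fin n) ℂ) - B).det = d)
    (he : (((t : ℂ) • (1 : Matrix (Fin n) (Fin n) ℂ) - B).updateRow i (Pi.single i 1)).det = e) :
    e ≤ 1 / t * (1 + 1 / (t - lam)) * d := by
  set Q := (t : ℂ) • (1 : Matrix (Fin n) (Fin n) ℂ) - B with hQ
  set y : Fin n → ℂ := Q.adjugate *ᵥ Pi.single i 1 with hy
  have hyi : y i = e := by
    rw [← he, ← adjugate_apply, hy, mulVec_single_one]; rfl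
  have hBy : B *ᵥ y = (t : ℂ) • y - (d : ℂ) • Pi.single i 1 := by
    have h1 : Q *ᵥ y = (d : ℂ) • Pi.single i 1 := by
      rw [hy, mulVec_mulVec, mul_adjugate, hd, smul_mulVec, one_mulVec]
    rw [hQ, sub_mulVec, smul_mulVec, one_mulVec] at h1
    rw [← h1]; abel
  set β := t * e - d with hβ
  have hβi : (B *ᵥ y) i = (β : ℂ) := by
    rw [hBy]; simp [hyi, hβ]
  have h1 : nsq (B *ᵥ y) = t * energySq B y - d * β := by
    have : ((nsq (B *ᵥ y) : ℝ) : ℂ) = t * energySq B y - d * β := by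
      rw [← star_dotProduct_self]
      nth_rw 2 [hBy]
      rw [dotProduct_sub, dotProduct_smul, dotProduct_smul, ← hB.1.dotProduct_mulVec_eq,
        ← hB.1.coe_energySq, dotProduct_single, Pi.star_apply, hβi]
      simp
    exact_mod_cast this
  have h2 := nsq_mulVec_le hB hle y
  have h3 := energySq_cauchy_schwarz hB (Pi.single i 1) y
  have h4 : star (Pi.single i (1 : ℂ)) ⬝ᵥ (B *ᵥ y) = (β : ℂ) := by
    rw [← hβi]; simp
  have h5 : energySq B (Pi.single i 1) = 1 := by
    simp [energySq, hi]
  rw [h4, h5, Complex.normSq_ofReal, one_mul] at h3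
  have h6 : β ≤ d / (t - lam) := by
    rw [le_div_iff₀ (by linarith)]
    by_contra hcon
    push Not at hcon
    have hβ0 : 0 < β := by
      by_contra h; push Not at h; nlinarith
    nlinarith [mul_lt_mul_of_pos_left hcon hβ0]
  rw [div_mul_eq_mul_div, one_mul, div_mul_eq_mul_div, le_div_iff₀ ht0, add_mul, one_mul,
    div_mul_eq_mul_div, one_mul]
  linarith

theorem val_pd_colorDet_le {r : ℕ} {B : Matrix (Fin n) (Fin n) ℂ} (hB : B.PosSemidef) {lam t : ℝ}
    (hle : ∀ v, energySq B v ≤ lam * nsq v) (ht : lam < t) (ht0 : 0 < t)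
    (a : Fin n × Fin r) (hi : B a.1 a.1 = 1) :
    val (pd a (colorDet B [])) (fun _ => t)
      ≤ 1 / t * (1 + 1 / (t - lam))
        * val (colorDet B ([] : List (Fin n × Fin r))) (fun _ => t) := by
  obtain ⟨i, j⟩ := a
  obtain ⟨d, hd0, hd⟩ := exists_det_eq hB.1 hle ht ht0
  obtain ⟨e, he0, he⟩ := exists_det_updateRow_eq hB.1 hle ht ht0 i
  have h := det_updateRow_le hB hle ht ht0 hi hd0 hd he
  have h1 : val (colorDet B ([] : List (Fin n × Fin r))) (fun _ => t)
      = d * d ^ (Finset.univ.erase j).card := by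
    rw [val, colorDet, ← Finset.mul_prod_erase _ _ (Finset.mem_univ j)]
    simp only [rowMat_nil_const, hd, Finset.prod_const]
    norm_cast
  have h2 : val (pd (i, j) (colorDet B ([] : List (Fin n × Fin r)))) (fun _ => t)
      = e * d ^ (Finset.univ.erase j).card := by
    rw [pd_colorDet B (by simp), val, colorDet, ← Finset.mul_prod_erase _ _ (Finset.mem_univ j),
      Finset.prod_congr rfl (g := fun _ => (d : ℂ))]
    · rw [rowMat_singleton_const, if_pos rfl, he, Finset.prod_const]
      norm_cast
    · intro j' hj'
      rw [rowMat_singleton_const, if_neg (Finset.ne_of_mem_erase hj'), hd]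
  rw [h1, h2, ← mul_assoc]
  gcongr

theorem energySq_mul_mul {B D : Matrix (Fin n) (Fin n) ℂ} (hD : D.IsHermitian) {v : Fin n → ℂ} :
    energySq (D * B * D) v = energySq B (D *ᵥ v) := by
  rw [energySq, energySq, mul_assoc, ← mulVec_mulVec, ← mulVec_mulVec, hD.dotProduct_mulVec_eq]

/-- Paving of a positive semi-definite matrix with unit diagonal: its indices can be colored so that
the compressions to the color classes are bounded. -/
theorem exists_paving {r : ℕ} {B : Matrix (Fin n) (Fin n) ℂ} (hB : B.PosSemidef)
    (hdiag : ∀ i, B i i = 1) {lam b δ : ℝ} (hle : ∀ v, energySq B v ≤ lam * nsq v) (hb : lam < b)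
    (hb0 : 0 < b) (hδ0 : 0 ≤ δ) (hδb : δ ≤ b)
    (hδ : ((r : ℝ) + 1) ^ 2 * (1 / b * (1 + 1 / (b - lam))) * δ ≤ (r : ℝ) ^ 2) :
    ∃ c : Fin n → Fin (r + 1), ∀ (v : Fin n → ℂ) (j : Fin (r + 1)),
      (∀ i, c i ≠ j → v i = 0) → energySq B v ≤ (b - δ) * nsq v := by
  set L : List (List (Fin n × Fin (r + 1))) :=
    (List.finRange n).map fun i => (List.finRange (r + 1)).map (Prod.mk i) with hL
  have hmem : ∀ a, a ∈ L.flatten := by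
    rintro ⟨i, j⟩
    simp [hL]
  have hlen : ∀ l ∈ L, l.length = r + 1 := by
    intro l hl
    obtain ⟨i, -, rfl⟩ := List.mem_map.1 hl
    simp
  have hnd : L.flatten.Nodup := by
    rw [List.nodup_flatten]
    refine ⟨?_, ?_⟩
    · intro l hl
      obtain ⟨i, -, rfl⟩ := List.mem_map.1 hl
      exact (List.nodup_finRange _).map (Prod.mk_right_injective i)
    · rw [hL, List.pairwise_map]
      refine (List.nodup_finRange n).imp ?_
      intro i i' hne a h1 h2
      obtain ⟨_, -, rfl⟩ := List.mem_map.1 h1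
      obtain ⟨_, -, h3⟩ := List.mem_map.1 h2
      exact hne (Prod.mk.inj h3).1.symm
  have hpos : ∀ t, b ≤ t → Pos (colorDet B []) (Set.univ : Set (Fin n × Fin (r + 1)))
      (fun _ => t) := by
    intro t ht l hl _
    rw [top_colorDet B hl]
    exact val_colorDet_pos hB.1 hl (hb0.trans_le ht) (energySq_lt hle (hb.trans_le ht))
  have hbar : ∀ t, b - δ ≤ t → 0 < val (cotops L (colorDet B [])) (fun _ => t) := by
    intro t ht
    have hbt : b ≤ t + δ := by linarith
    have hb' : 0 < b - lam := by linarith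
    have hφ : 0 < 1 / (t + δ) * (1 + 1 / (t + δ - lam)) := by
      have : 0 < t + δ := by linarith
      have : 0 < t + δ - lam := by linarith
      positivity
    have hB' : Barrier (colorDet B []) (Set.univ : Set (Fin n × Fin (r + 1)))
        (1 / (t + δ) * (1 + 1 / (t + δ - lam))) (fun _ => t + δ) :=
      ⟨isStable_colorDet hB.1, hpos _ hbt, fun a _ =>
        val_pd_colorDet_le hB hle (by linarith) (by linarith) a (hdiag _)⟩
    have h := (hB'.cotops hφ (r := r) (δ := δ) ?_ L hlen hnd (by simp)).pos.val_pos
    · have e : shift L.flatten (-δ) (fun _ : Fin n × Fin (r + 1) => t + δ) = fun _ => t := by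
        ext a
        simp only [shift, hmem a, if_true]
        ring
      rwa [e] at h
    · refine le_trans ?_ hδ
      have : 0 < t + δ - lam := by linarith
      gcongr
  obtain ⟨M, hM, -, hML, hMpos⟩ := (isStable_colorDet hB.1).exists_top_pos (L := L)
    (fun l hl h => by simpa [h] using hlen l hl) hnd (by simp) hpos hbar
  have hc : ∀ i : Fin n, ∃ j : Fin (r + 1), (i, j) ∉ M := by
    intro i
    obtain ⟨a, ha, haM⟩ := hML _ (List.mem_map_of_mem (List.mem_finRange i))
    obtain ⟨j, -, rfl⟩ := List.mem_map.1 ha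
    exact ⟨j, haM⟩
  choose c hc using hc
  refine ⟨c, fun v j hv => ?_⟩
  by_contra hcon
  push Not at hcon
  set D : Matrix (Fin n) (Fin n) ℂ := diagonal fun i => if (i, j) ∈ M then 0 else 1 with hD
  have hDv : ∀ (w : Fin n → ℂ) i, (D *ᵥ w) i = if (i, j) ∈ M then 0 else w i := by
    intro w i
    rw [hD, mulVec_diagonal]
    split_ifs <;> simp
  have hDH : D.IsHermitian := by
    rw [hD, isHermitian_diagonal_iff]
    intro i
    split_ifs
    · exact .zero _
    · exact .one _
  have hDBH : (D * B * D).IsHermitian := by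
    have := isHermitian_mul_mul_conjTranspose D hB.1
    rwa [hDH.eq] at this
  have hDvv : D *ᵥ v = v := by
    ext i
    rw [hDv]
    split_ifs with h
    · refine (hv i ?_).symm
      rintro rfl
      exact hc i h
    · rfl
  rw [← hDvv, ← energySq_mul_mul hDH, hDvv] at hcon
  obtain ⟨μ, hμ, w, hw, hw'⟩ := hDBH.exists_eigenvector hcon
  have hμ0 : (μ : ℂ) ≠ 0 := by
    have : 0 < μ := by linarith
    exact_mod_cast this.ne'
  rw [mul_assoc, ← mulVec_mulVec, ← mulVec_mulVec] at hw'
  have hw0 : ∀ i, (i, j) ∈ M → w i = 0 := by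
    intro i hi
    have := congrFun hw' i
    rw [hDv, if_pos hi, Pi.smul_apply, smul_eq_mul] at this
    exact (mul_eq_zero.1 this.symm).resolve_left hμ0
  have hDw : D *ᵥ w = w := by
    ext i
    rw [hDv]
    split_ifs with h
    · exact (hw0 i h).symm
    · rfl
  rw [hDw] at hw'
  have hdet : (rowMat B M (cplx fun _ => μ) j).det = 0 := by
    refine exists_mulVec_eq_zero_iff.1 ⟨w, hw, ?_⟩
    ext i
    rw [rowMat_mulVec]
    split_ifs with h
    · exact hw0 i h
    · have := congrFun hw' i
      rw [hDv, if_neg h] at this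
      rw [this]
      simp [cplx]
  have := hMpos μ hμ.le
  rw [top_colorDet B hM, val, colorDet, Finset.prod_eq_zero (Finset.mem_univ j) hdet] at this
  simp at this

end MultiAffine

section SpecNorm

variable {n : ℕ}

theorem nsq_eq_norm_sq (x : EuclideanSpace ℂ (Fin n)) : nsq x.ofLp = ‖x‖ ^ 2 := by
  simp [nsq, EuclideanSpace.norm_sq_eq, Complex.normSq_eq_norm_sq]

theorem specNorm_nonneg (M : Matrix (Fin n) (Fin n) ℂ) : 0 ≤ specNorm M := norm_nonneg _

theorem specNorm_le {M : Matrix (Fin n) (Fin n) ℂ} {C : ℝ} (hC : 0 ≤ C)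
    (h : ∀ v, nsq (M *ᵥ v) ≤ C ^ 2 * nsq v) : specNorm M ≤ C := by
  refine ContinuousLinearMap.opNorm_le_bound _ hC fun x => ?_
  have := h x.ofLp
  rw [← ofLp_toEuclideanCLM, nsq_eq_norm_sq, nsq_eq_norm_sq, ← mul_pow] at this
  exact le_of_sq_le_sq this (by positivity)

theorem nsq_mulVec_le_specNorm (M : Matrix (Fin n) (Fin n) ℂ) (v : Fin n → ℂ) :
    nsq (M *ᵥ v) ≤ specNorm M ^ 2 * nsq v := by
  have h := (toEuclideanCLM (𝕜 := ℂ) (n := Fin n) M).le_opNorm (WithLp.toLp 2 v)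
  have h1 := nsq_eq_norm_sq (toEuclideanCLM (𝕜 := ℂ) (n := Fin n) M (WithLp.toLp 2 v))
  have h2 := nsq_eq_norm_sq (WithLp.toLp 2 v)
  rw [ofLp_toEuclideanCLM] at h1
  rw [h1, h2, ← mul_pow]
  exact pow_le_pow_left₀ (norm_nonneg _) h 2

theorem specNorm_add_le (M N : Matrix (Fin n) (Fin n) ℂ) :
    specNorm (M + N) ≤ specNorm M + specNorm N := by
  rw [specNorm, map_add]; exact norm_add_le _ _

theorem specNorm_mul_le (M N : Matrix (Fin n) (Fin n) ℂ) :
    specNorm (M * N) ≤ specNorm M * specNorm N := by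
  rw [specNorm, map_mul]; exact norm_mul_le _ _

theorem specNorm_smul (c : ℂ) (M : Matrix (Fin n) (Fin n) ℂ) :
    specNorm (c • M) = ‖c‖ * specNorm M := by
  rw [specNorm, map_smul, norm_smul, specNorm]

theorem specNorm_zero : specNorm (0 : Matrix (Fin n) (Fin n) ℂ) = 0 := by
  rw [specNorm, map_zero, norm_zero]

theorem specNorm_diagonal_ite_le_one (p : Fin n → Prop) [DecidablePred p] :
    specNorm (diagonal fun i => if p i then (1 : ℂ) else 0) ≤ 1 := by
  refine specNorm_le zero_le_one fun v => ?_
  rw [one_pow, one_mul]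
  refine Finset.sum_le_sum fun i _ => ?_
  rw [mulVec_diagonal]
  split_ifs
  · rw [one_mul]
  · rw [zero_mul, map_zero]; exact Complex.normSq_nonneg _

theorem specNorm_one_le : specNorm (1 : Matrix (Fin n) (Fin n) ℂ) ≤ 1 := by
  simpa using specNorm_diagonal_ite_le_one (n := n) fun _ => True

end SpecNorm

section Pinch

variable {n : ℕ}

theorem energySq_neg (A : Matrix (Fin n) (Fin n) ℂ) (v : Fin n → ℂ) :
    energySq (-A) v = -energySq A v := by
  simp [energySq, neg_mulVec]

theorem energySq_add (A B : Matrix (Fin n) (Fin n) ℂ) (v : Fin n → ℂ) :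
    energySq (A + B) v = energySq A v + energySq B v := by
  simp [energySq, add_mulVec]

theorem energySq_smul (c : ℝ) (A : Matrix (Fin n) (Fin n) ℂ) (v : Fin n → ℂ) :
    energySq ((c : ℂ) • A) v = c * energySq A v := by
  rw [energySq, smul_mulVec, dotProduct_smul, smul_eq_mul, Complex.re_ofReal_mul, energySq]

/-- The block-diagonal part of a matrix with respect to a coloring of the indices. -/
def pinch (k : Fin n → ℕ) (A : Matrix (Fin n) (Fin n) ℂ) : Matrix (Fin n) (Fin n) ℂ :=
  Matrix.of fun i j => if k i = k j then A i j else 0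

theorem pinch_neg (k : Fin n → ℕ) (A : Matrix (Fin n) (Fin n) ℂ) : pinch k (-A) = -pinch k A := by
  ext i j
  by_cases h : k i = k j <;> simp [pinch, h]

theorem energySq_pinch (k : Fin n → ℕ) (A : Matrix (Fin n) (Fin n) ℂ) (v : Fin n → ℂ) :
    energySq (pinch k A) v
      = ∑ m ∈ Finset.univ.image k, energySq A fun i => if k i = m then v i else 0 := by
  simp only [energySq]
  rw [← Complex.re_sum]
  congr 1
  simp only [dotProduct, mulVec, Finset.mul_sum]
  rw [Finset.sum_comm (s := Finset.univ.image k)]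
  refine Finset.sum_congr rfl fun i _ => ?_
  rw [Finset.sum_comm (s := Finset.univ.image k)]
  refine Finset.sum_congr rfl fun j _ => ?_
  rw [Finset.sum_eq_single_of_mem (k i) (Finset.mem_image_of_mem k (Finset.mem_univ i))]
  · simp only [pinch, of_apply, Pi.star_apply, if_true, @eq_comm _ (k i) (k j)]
    split_ifs <;> simp
  · intro m _ hm
    simp [hm.symm]

theorem nsq_eq_sum_color (k : Fin n → ℕ) (v : Fin n → ℂ) :
    nsq v = ∑ m ∈ Finset.univ.image k, nsq fun i => if k i = m then v i else 0 := by
  simp only [nsq]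
  rw [Finset.sum_comm]
  refine Finset.sum_congr rfl fun i _ => ?_
  rw [Finset.sum_eq_single_of_mem (k i) (Finset.mem_image_of_mem k (Finset.mem_univ i))]
  · simp
  · intro m _ hm
    simp [hm.symm]

theorem energySq_pinch_le {k : Fin n → ℕ} {A : Matrix (Fin n) (Fin n) ℂ} {a : ℝ}
    (h : ∀ (v : Fin n → ℂ) m, (∀ i, k i ≠ m → v i = 0) → energySq A v ≤ a * nsq v)
    (v : Fin n → ℂ) : energySq (pinch k A) v ≤ a * nsq v := by
  rw [energySq_pinch, nsq_eq_sum_color k v, Finset.mul_sum]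
  exact Finset.sum_le_sum fun m _ => h _ m fun i hi => if_neg hi

/-- A Hermitian matrix with zero diagonal whose quadratic form is bounded. -/
structure FormBounded (A : Matrix (Fin n) (Fin n) ℂ) (a : ℝ) : Prop where
  herm : A.IsHermitian
  diag : ∀ i, A i i = 0
  le : ∀ v, energySq A v ≤ a * nsq v
  neg_le : ∀ v, energySq (-A) v ≤ a * nsq v

theorem FormBounded.neg {A : Matrix (Fin n) (Fin n) ℂ} {a : ℝ} (h : FormBounded A a) :
    FormBounded (-A) a where
  herm := h.herm.neg
  diag i := by simp [h.diag i]
  le := h.neg_le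
  neg_le := by simpa using h.le

theorem FormBounded.pinch {A : Matrix (Fin n) (Fin n) ℂ} {a : ℝ} (h : FormBounded A a)
    (k : Fin n → ℕ) : FormBounded (pinch k A) a where
  herm := by
    ext i j
    have := h.herm.apply i j
    by_cases hij : k i = k j
    · simpa [_root_.pinch, hij] using this
    · simp [_root_.pinch, hij, Ne.symm hij]
  diag i := by simp [_root_.pinch, h.diag i]
  le := energySq_pinch_le fun v _ _ => h.le v
  neg_le := by
    rw [← pinch_neg]
    exact energySq_pinch_le fun v _ _ => h.neg_le v

theorem FormBounded.specNorm_le {A : Matrix (Fin n) (Fin n) ℂ} {a : ℝ} (h : FormBounded A a)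
    (ha : 0 ≤ a) : specNorm A ≤ a := by
  refine _root_.specNorm_le ha fun v => ?_
  have hen : ∀ v, energySq ((a : ℂ) • (1 : Matrix (Fin n) (Fin n) ℂ) + A) v
      = a * nsq v + energySq A v := by
    intro v
    rw [energySq_add, energySq_smul, energySq_one]
  have hH : ((a : ℂ) • (1 : Matrix (Fin n) (Fin n) ℂ) + A).IsHermitian := by
    refine IsHermitian.add ?_ h.herm
    simp [IsHermitian, conjTranspose_smul]
  have hP := posSemidef_of_energySq_nonneg hH fun v => by
    have := h.neg_le v
    rw [energySq_neg] at this
    rw [hen]; linarith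
  have h1 := nsq_mulVec_le hP (lam := 2 * a) (fun v => by rw [hen]; linarith [h.le v]) v
  rw [hen] at h1
  have h2 := IsHermitian.energySq_add_smul (B := 1) isHermitian_one v (A *ᵥ v) (a : ℂ)
  rw [energySq_one, energySq_one, energySq_one, one_mulVec, Complex.conj_ofReal,
    Complex.re_ofReal_mul, Complex.normSq_ofReal] at h2
  rw [add_mulVec, smul_mulVec, one_mulVec, add_comm, h2] at h1
  simp only [energySq] at h1
  nlinarith

end Pinch

section Ordering

variable {n : ℕ}

/-- The part of a matrix below the diagonal with respect to an ordering of the indices. -/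
def lowerPart (ρ : Fin n → ℕ) (A : Matrix (Fin n) (Fin n) ℂ) : Matrix (Fin n) (Fin n) ℂ :=
  Matrix.of fun i j => if ρ j < ρ i then A i j else 0

/-- For some ordering of the indices the lower triangular part of the matrix is bounded. -/
def HasOrdering (A : Matrix (Fin n) (Fin n) ℂ) (C : ℝ) : Prop :=
  ∃ ρ : Fin n → ℕ, Function.Injective ρ ∧ specNorm (lowerPart ρ A) ≤ C

theorem HasOrdering.mono {A : Matrix (Fin n) (Fin n) ℂ} {C C' : ℝ} (h : HasOrdering A C)
    (hC : C ≤ C') : HasOrdering A C' :=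
  let ⟨ρ, hρ, hn⟩ := h
  ⟨ρ, hρ, hn.trans hC⟩

theorem HasOrdering.of_pinch_mod_two {A : Matrix (Fin n) (Fin n) ℂ} {C a : ℝ} {c : Fin n → ℕ}
    (hA : specNorm A ≤ a) (hc : ∀ i, c i < 2) (h : HasOrdering (pinch c A) C) :
    HasOrdering A (C + a) := by
  obtain ⟨ρ, hρ, hn⟩ := h
  obtain ⟨N, hN⟩ : ∃ N, ∀ i, ρ i < N :=
    ⟨∑ i, ρ i + 1, fun i => Nat.lt_succ_of_le (Finset.single_le_sum (f := ρ)
      (fun _ _ => Nat.zero_le _) (Finset.mem_univ i))⟩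
  have hval : ∀ i, c i = 0 ∨ c i = 1 := fun i => by have := hc i; omega
  refine ⟨fun i => c i * N + ρ i, ?_, ?_⟩
  · intro i j hij
    have h1 := hN i
    have h2 := hN j
    apply hρ
    rcases hval i with hi | hi <;> rcases hval j with hj | hj <;>
      simp only [hi, hj, zero_mul, one_mul, zero_add] at hij <;> omega
  · have e : lowerPart (fun i => c i * N + ρ i) A = lowerPart ρ (pinch c A)
        + (diagonal fun i => if c i = 1 then (1 : ℂ) else 0) * A
          * (diagonal fun i => if c i = 0 then (1 : ℂ) else 0) := by
      ext i j
      have h1 := hN i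
      have h2 := hN j
      rw [Matrix.add_apply, mul_diagonal, diagonal_mul]
      simp only [lowerPart, pinch, of_apply]
      rcases hval i with hi | hi <;> rcases hval j with hj | hj <;> simp [hi, hj]
      · intro h3; omega
      · intro h3; omega
    have h0 := specNorm_nonneg A
    rw [e]
    refine (specNorm_add_le _ _).trans (add_le_add hn ?_)
    calc _ ≤ _ := specNorm_mul_le _ _
      _ ≤ (1 * specNorm A) * 1 := by
        refine mul_le_mul ((specNorm_mul_le _ _).trans ?_) (specNorm_diagonal_ite_le_one _)
          (specNorm_nonneg _) (by positivity)
        exact mul_le_mul_of_nonneg_right (specNorm_diagonal_ite_le_one _) h0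
      _ ≤ a := by simpa using hA

theorem pinch_pinch_div (k : Fin n → ℕ) (A : Matrix (Fin n) (Fin n) ℂ) :
    pinch (fun i => k i % 2) (pinch (fun i => k i / 2) A) = pinch k A := by
  ext i j
  simp only [pinch, of_apply, ← ite_and]
  congr 1
  simp only [eq_iff_iff]
  omega

theorem HasOrdering.of_pinch {A : Matrix (Fin n) (Fin n) ℂ} {C a : ℝ} (hA : FormBounded A a)
    (ha : 0 ≤ a) {s : ℕ} {k : Fin n → ℕ} (hk : ∀ i, k i < 2 ^ s) (h : HasOrdering (pinch k A) C) :
    HasOrdering A (C + s * a) := by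
  induction s generalizing C k with
  | zero =>
    have : pinch k A = A := by
      ext i j
      have h1 := hk i
      have h2 := hk j
      simp only [pow_zero, Nat.lt_one_iff] at h1 h2
      simp [pinch, h1, h2]
    simpa [this] using h
  | succ s ih =>
    rw [← pinch_pinch_div] at h
    have h1 := h.of_pinch_mod_two ((hA.pinch _).specNorm_le ha) fun i => Nat.mod_lt _ two_pos
    refine (ih (k := fun i => k i / 2) (fun i => ?_) h1).mono (by push_cast; linarith)
    have := hk i
    rw [pow_succ] at this
    omega

theorem FormBounded.hasOrdering_nat {A : Matrix (Fin n) (Fin n) ℂ} {a : ℝ} (hA : FormBounded A a)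
    (ha : 0 ≤ a) : HasOrdering A (n * a) := by
  have h : HasOrdering (_root_.pinch (fun i => (i : ℕ)) A) 0 := by
    refine ⟨fun i => i, Fin.val_injective, ?_⟩
    have : lowerPart (fun i => (i : ℕ)) (_root_.pinch (fun i => (i : ℕ)) A) = 0 := by
      ext i j
      simp only [lowerPart, _root_.pinch, of_apply, Matrix.zero_apply]
      split_ifs with h1 h2
      · omega
      · rfl
      · rfl
    rw [this, specNorm_zero]
  simpa using h.of_pinch hA ha fun i => i.2.trans Nat.lt_two_pow_self

theorem FormBounded.exists_pinch_le {A : Matrix (Fin n) (Fin n) ℂ} {a : ℝ} (hA : FormBounded A a)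
    (ha : 0 < a) : ∃ k : Fin n → ℕ, (∀ i, k i < 2 ^ 6) ∧
      ∀ v, energySq (_root_.pinch k A) v ≤ 0.36 * a * nsq v := by
  set B : Matrix (Fin n) (Fin n) ℂ := 1 + ((a⁻¹ : ℝ) : ℂ) • A with hB
  have hen : ∀ v, energySq B v = nsq v + a⁻¹ * energySq A v := by
    intro v
    rw [hB, energySq_add, energySq_smul, energySq_one]
  have hH : B.IsHermitian := by
    refine isHermitian_one.add ?_
    rw [IsHermitian, conjTranspose_smul, hA.herm.eq]
    simp
  have hP : B.PosSemidef := posSemidef_of_energySq_nonneg hH fun v => by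
    have h1 := hA.neg_le v
    rw [energySq_neg, _root_.neg_le] at h1
    have h2 := mul_le_mul_of_nonneg_left h1 (inv_nonneg.2 ha.le)
    rw [mul_neg, ← mul_assoc, inv_mul_cancel₀ ha.ne'] at h2
    rw [hen]; linarith
  have hle : ∀ v, energySq B v ≤ 2 * nsq v := by
    intro v
    have h2 := mul_le_mul_of_nonneg_left (hA.le v) (inv_nonneg.2 ha.le)
    rw [← mul_assoc, inv_mul_cancel₀ ha.ne'] at h2
    rw [hen]; linarith
  obtain ⟨c, hc⟩ := MultiAffine.exists_paving (r := 63) (b := 8) (δ := 6.64) hP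
    (fun i => by simp [hB, hA.diag i]) hle (by norm_num) (by norm_num) (by norm_num) (by norm_num)
    (by norm_num)
  refine ⟨fun i => c i, fun i => (c i).2, energySq_pinch_le fun v m hv => ?_⟩
  by_cases hm : m < 63 + 1
  · have h1 := hc v ⟨m, hm⟩ fun i hi => hv i fun h => hi (Fin.ext h)
    rw [hen] at h1
    have h2 : a⁻¹ * energySq A v ≤ 0.36 * nsq v := by linarith
    rw [inv_mul_le_iff₀ ha] at h2
    linarith
  · have : v = 0 := funext fun i => hv i fun h => hm (h ▸ (c i).2)
    subst this
    simp [energySq, nsq]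

theorem FormBounded.hasOrdering_of_forall {A : Matrix (Fin n) (Fin n) ℂ} {a C : ℝ}
    (hA : FormBounded A a) (ha : 0 < a)
    (h : ∀ A' : Matrix (Fin n) (Fin n) ℂ, FormBounded A' (0.36 * a) → HasOrdering A' C) :
    HasOrdering A (C + 12 * a) := by
  obtain ⟨k, hk, hk'⟩ := hA.exists_pinch_le ha
  obtain ⟨m, hm, hm'⟩ := (hA.pinch k).neg.exists_pinch_le ha
  rw [pinch_neg] at hm'
  have h1 := h (_root_.pinch m (_root_.pinch k A))
    ⟨((hA.pinch k).pinch m).herm, ((hA.pinch k).pinch m).diag,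
      energySq_pinch_le fun v _ _ => hk' v, hm'⟩
  exact ((h1.of_pinch (hA.pinch k) ha.le hm).of_pinch hA ha.le hk).mono
    (by push_cast; linarith)

theorem FormBounded.hasOrdering {A : Matrix (Fin n) (Fin n) ℂ} {a : ℝ} (hA : FormBounded A a)
    (ha : 0 < a) : HasOrdering A (20 * a) := by
  have key : ∀ (m : ℕ) (a : ℝ), 0 < a → ∀ A : Matrix (Fin n) (Fin n) ℂ, FormBounded A a →
      HasOrdering A ((18.75 + 0.36 ^ m * n) * a) := by
    intro m
    induction m with
    | zero =>
      intro a ha A hA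
      exact (hA.hasOrdering_nat ha.le).mono (by nlinarith)
    | succ m ih =>
      intro a ha A hA
      refine (hA.hasOrdering_of_forall ha (ih (0.36 * a) (by positivity))).mono (le_of_eq ?_)
      rw [pow_succ]; ring
  obtain ⟨m, hm⟩ := exists_pow_lt_of_lt_one (x := 1 / ((n : ℝ) + 1)) (y := 0.36) (by positivity)
    (by norm_num)
  refine (key m a ha A hA).mono (mul_le_mul_of_nonneg_right ?_ ha.le)
  rw [lt_div_iff₀ (by positivity)] at hm
  have : (0 : ℝ) ≤ 0.36 ^ m := by positivity
  linarith

end Ordering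

section Spectral

variable {n : ℕ}

/-- The quadratic form of a matrix diagonal in the eigenbasis of a Hermitian matrix is bounded by
any bound on its diagonal entries there. -/
theorem Matrix.IsHermitian.energySq_le_of_eigenvectorBasis {B M : Matrix (Fin n) (Fin n) ℂ}
    (hB : B.IsHermitian) (hM : M.IsHermitian) {f : Fin n → ℝ} {c : ℝ}
    (hf : ∀ i, M *ᵥ (hB.eigenvectorBasis i).ofLp = (f i : ℂ) • (hB.eigenvectorBasis i).ofLp)
    (hc : ∀ i, f i ≤ c) (v : Fin n → ℂ) : energySq M v ≤ c * nsq v := by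
  by_contra hcon
  push Not at hcon
  obtain ⟨μ, hμ, w, hw, hw'⟩ := hM.exists_eigenvector hcon
  have h0 : ∀ i, inner ℂ (hB.eigenvectorBasis i) (WithLp.toLp 2 w) = 0 := by
    intro i
    have h1 := hM.dotProduct_mulVec_eq (hB.eigenvectorBasis i).ofLp w
    rw [hw', hf, star_smul, dotProduct_smul, smul_dotProduct, RCLike.star_def, Complex.conj_ofReal,
      smul_eq_mul, smul_eq_mul, ← sub_eq_zero, ← sub_mul, mul_eq_zero] at h1
    rw [EuclideanSpace.inner_eq_star_dotProduct, dotProduct_comm]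
    refine h1.resolve_left fun h2 => ?_
    rw [sub_eq_zero] at h2
    have h3 : μ = f i := by exact_mod_cast h2
    linarith [hc i]
  apply hw
  have h1 : WithLp.toLp 2 w = (0 : EuclideanSpace ℂ (Fin n)) := by
    rw [← hB.eigenvectorBasis.sum_repr' (WithLp.toLp 2 w)]
    simp [h0]
  simpa using congrArg WithLp.ofLp h1

theorem Matrix.IsHermitian.energySq_le_of_eigenvalues_le {B : Matrix (Fin n) (Fin n) ℂ}
    (hB : B.IsHermitian) {c : ℝ} (hc : ∀ i, hB.eigenvalues i ≤ c) (v : Fin n → ℂ) :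
    energySq B v ≤ c * nsq v :=
  hB.energySq_le_of_eigenvectorBasis hB (fun i => by
    rw [hB.mulVec_eigenvectorBasis]; rfl) hc v

theorem Matrix.PosSemidef.mul_energySq_le_nsq_mulVec {B : Matrix (Fin n) (Fin n) ℂ}
    (hB : B.PosSemidef) {c : ℝ} (hc : ∀ i, hB.1.eigenvalues i ≠ 0 → c ≤ hB.1.eigenvalues i)
    (v : Fin n → ℂ) : c * energySq B v ≤ nsq (B *ᵥ v) := by
  have hM : ((c : ℂ) • B - B * B).IsHermitian := by
    refine IsHermitian.sub ?_ ?_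
    · rw [IsHermitian, conjTranspose_smul, hB.1.eq]; simp
    · rw [IsHermitian, conjTranspose_mul, hB.1.eq]
  have h := hB.1.energySq_le_of_eigenvectorBasis hM (c := 0)
    (f := fun i => c * hB.1.eigenvalues i - hB.1.eigenvalues i ^ 2) (fun i => ?_) (fun i => ?_) v
  · have e : energySq (B * B) v = nsq (B *ᵥ v) := by
      rw [energySq, ← mulVec_mulVec, hB.1.dotProduct_mulVec_eq, star_dotProduct_self,
        Complex.ofReal_re]
    rw [sub_eq_add_neg, energySq_add, energySq_neg, energySq_smul, e] at h
    linarith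
  · have h1 : B *ᵥ (hB.1.eigenvectorBasis i).ofLp
        = (hB.1.eigenvalues i : ℂ) • (hB.1.eigenvectorBasis i).ofLp := by
      rw [hB.1.mulVec_eigenvectorBasis]; rfl
    rw [sub_mulVec, smul_mulVec, ← mulVec_mulVec, h1, mulVec_smul, h1, smul_smul, smul_smul,
      ← sub_smul]
    push_cast
    ring_nf
  · by_cases h0 : hB.1.eigenvalues i = 0
    · simp [h0]
    · have h1 := hc i h0
      have h2 := hB.eigenvalues_nonneg i
      nlinarith

end Spectral

section SOR

variable {n : ℕ}

theorem lowerTri_submatrix {ρ : Fin n → ℕ} {σ : Equiv.Perm (Fin n)} (h : StrictMono (ρ ∘ σ))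
    (B : Matrix (Fin n) (Fin n) ℂ) :
    lowerTri (B.submatrix σ σ) = (lowerPart ρ B).submatrix σ σ := by
  ext i j
  have : ρ (σ j) < ρ (σ i) ↔ j < i := h.lt_iff_lt
  simp [lowerTri, lowerPart, this]

theorem det_one_add_smul_lowerTri (c : ℂ) (M : Matrix (Fin n) (Fin n) ℂ) :
    (1 + c • lowerTri M).det = 1 := by
  rw [det_of_isLowerTriangular]
  · simp [lowerTri]
  · intro i j hij
    have h : i < j := hij
    simp [lowerTri, h.ne, h.not_gt]

/-- A step of the permuted iteration moves along the solution of a system triangular for the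
corresponding ordering. -/
theorem exists_sorStepPerm_eq {ρ : Fin n → ℕ} {σ : Equiv.Perm (Fin n)} (h : StrictMono (ρ ∘ σ))
    (B : Matrix (Fin n) (Fin n) ℂ) (ω : ℝ) (b v : Fin n → ℂ) :
    ∃ u, sorStepPerm B ω b σ v = v + (ω : ℂ) • u ∧
      u + (ω : ℂ) • (lowerPart ρ B *ᵥ u) = b - B *ᵥ v := by
  refine ⟨_, rfl, ?_⟩
  set f : Fin n → ℂ := fun j => (b - B *ᵥ v) (σ j) with hf
  set Q := 1 + (ω : ℂ) • lowerTri (B.submatrix σ σ) with hQ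
  have h1 : Q *ᵥ (Q⁻¹ *ᵥ f) = f := by
    rw [mulVec_mulVec, mul_nonsing_inv _ (by rw [hQ, det_one_add_smul_lowerTri]; exact isUnit_one),
      one_mulVec]
  have h2 : Q = (1 + (ω : ℂ) • lowerPart ρ B).submatrix σ σ := by
    rw [hQ, lowerTri_submatrix h, submatrix_add, submatrix_smul]
    simp
  nth_rw 1 [h2] at h1
  rw [submatrix_mulVec_equiv] at h1
  rw [← smul_mulVec]
  nth_rw 1 [← one_mulVec fun i => (Q⁻¹ *ᵥ f) (σ.symm i)]
  rw [← add_mulVec]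
  ext i
  have := congrFun h1 (σ.symm i)
  simp only [Function.comp_apply, Equiv.apply_symm_apply, hf] at this
  exact this

theorem energySq_eq_lowerPart {ρ : Fin n → ℕ} (hρ : Function.Injective ρ)
    {B : Matrix (Fin n) (Fin n) ℂ} (hB : B.IsHermitian) (hdiag : ∀ i, B i i = 1)
    (u : Fin n → ℂ) : energySq B u = nsq u + 2 * energySq (lowerPart ρ B) u := by
  have e : B = 1 + (lowerPart ρ B + (lowerPart ρ B)ᴴ) := by
    ext i j
    rcases lt_trichotomy (ρ i) (ρ j) with h | h | h
    · have hne : i ≠ j := fun h' => h.ne (congrArg ρ h')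
      have := hB.apply i j
      simp [lowerPart, h, h.not_gt, hne, ← this]
    · rw [hρ h]
      simp [lowerPart, hdiag]
    · have hne : i ≠ j := fun h' => h.ne' (congrArg ρ h')
      simp [lowerPart, h, h.not_gt, hne]
  have e2 : energySq (lowerPart ρ B)ᴴ u = energySq (lowerPart ρ B) u := by
    rw [energySq, energySq, dotProduct_mulVec, ← star_mulVec, ← Complex.conj_re, starRingEnd_apply,
      ← star_dotProduct_star, star_star, dotProduct_comm]
  nth_rw 1 [e]
  rw [energySq_add, energySq_add, energySq_one, e2]
  ring

theorem energySq_sub_smul_of_lowerPart {ρ : Fin n → ℕ} (hρ : Function.Injective ρ)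
    {B : Matrix (Fin n) (Fin n) ℂ} (hB : B.IsHermitian) (hdiag : ∀ i, B i i = 1) {ω : ℝ}
    {u e : Fin n → ℂ} (hu : u + (ω : ℂ) • (lowerPart ρ B *ᵥ u) = B *ᵥ e) :
    energySq B (e - (ω : ℂ) • u) = energySq B e - ω * (2 - ω) * nsq u := by
  have h1 := hB.energySq_add_smul u e (-ω)
  rw [← hu, dotProduct_add, star_dotProduct_self, dotProduct_smul,
    energySq_eq_lowerPart hρ hB hdiag u,
    map_neg, Complex.conj_ofReal, Complex.normSq_neg, Complex.normSq_ofReal, neg_smul,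
    ← sub_eq_add_neg] at h1
  rw [h1]
  simp only [energySq, smul_eq_mul, neg_mul, Complex.neg_re, Complex.re_ofReal_mul, Complex.add_re,
    Complex.ofReal_re]
  ring

theorem energySq_sor_error_le {ρ : Fin n → ℕ} (hρ : Function.Injective ρ)
    {B : Matrix (Fin n) (Fin n) ℂ} (hB : B.PosSemidef) (hdiag : ∀ i, B i i = 1) {ω C c : ℝ}
    (hω : 0 < ω) (hω2 : ω < 2) (hC0 : 0 ≤ C) (hC : specNorm (lowerPart ρ B) ≤ C)
    (hc : ∀ v, c * energySq B v ≤ nsq (B *ᵥ v)) {u e : Fin n → ℂ}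
    (hu : u + (ω : ℂ) • (lowerPart ρ B *ᵥ u) = B *ᵥ e) :
    energySq B (e - (ω : ℂ) • u)
      ≤ (1 - ω * (2 - ω) * (c / (1 + ω * C) ^ 2)) * energySq B e := by
  rw [energySq_sub_smul_of_lowerPart hρ hB.1 hdiag hu]
  have hD : 0 < 1 + ω * C := by positivity
  have h1 : specNorm (1 + (ω : ℂ) • lowerPart ρ B) ≤ 1 + ω * C := by
    refine (specNorm_add_le _ _).trans (add_le_add specNorm_one_le ?_)
    rw [specNorm_smul, Complex.norm_real, Real.norm_of_nonneg hω.le]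
    gcongr
  have h2 : nsq (B *ᵥ e) ≤ (1 + ω * C) ^ 2 * nsq u := by
    rw [← hu, ← smul_mulVec]
    nth_rw 1 [← one_mulVec u]
    rw [← add_mulVec]
    refine (nsq_mulVec_le_specNorm _ _).trans ?_
    have := specNorm_nonneg (1 + (ω : ℂ) • lowerPart ρ B)
    have := nsq_nonneg u
    gcongr
  have h3 : c / (1 + ω * C) ^ 2 * energySq B e ≤ nsq u := by
    rw [div_mul_eq_mul_div, div_le_iff₀ (by positivity)]
    linarith [hc e]
  have h4 : 0 < ω * (2 - ω) := mul_pos hω (by linarith)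
  nlinarith [mul_le_mul_of_nonneg_left h3 h4.le]

theorem formBounded_sub_one {B : Matrix (Fin n) (Fin n) ℂ} (hB : B.PosSemidef)
    (hdiag : ∀ i, B i i = 1) {lam : ℝ} (hle : ∀ v, energySq B v ≤ lam * nsq v) (hlam : 1 ≤ lam) :
    FormBounded (B - 1) lam where
  herm := hB.1.sub isHermitian_one
  diag i := by simp [hdiag i]
  le v := by
    rw [sub_eq_add_neg, energySq_add, energySq_neg, energySq_one]
    linarith [hle v, nsq_nonneg v]
  neg_le v := by
    rw [energySq_neg, sub_eq_add_neg, energySq_add, energySq_neg, energySq_one]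
    nlinarith [energySq_nonneg hB v, nsq_nonneg v]

theorem lowerPart_sub_one {ρ : Fin n → ℕ} (B : Matrix (Fin n) (Fin n) ℂ) :
    lowerPart ρ (B - 1) = lowerPart ρ B := by
  ext i j
  simp only [lowerPart, of_apply]
  split_ifs with h
  · have : i ≠ j := fun h' => h.ne' (congrArg ρ h')
    simp [this]
  · rfl

theorem one_le_of_energySq_le [NeZero n] {B : Matrix (Fin n) (Fin n) ℂ} (hdiag : ∀ i, B i i = 1)
    {lam : ℝ} (hle : ∀ v, energySq B v ≤ lam * nsq v) : 1 ≤ lam := by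
  have := hle (Pi.single 0 1)
  have h1 : nsq (Pi.single (0 : Fin n) (1 : ℂ)) = 1 := by
    rw [← energySq_one]; simp [energySq]
  simpa [energySq, hdiag, h1] using this

end SOR

/-- Theorem 4b: there is an absolute constant C₁ ≤ 32.42 such that some ordering σ makes
the classical SOR iteration for the permuted system satisfy the stated error bound. -/
theorem preshuffled_sor_error_bound :
    ∃ C₁ : ℝ, C₁ ≤ 32.42 ∧
      ∀ (n : ℕ) (B : Matrix (Fin n) (Fin n) ℂ) (hB : B.PosSemidef),
        (∀ i, B i i = 1) →
        ∀ lam1 lamr : ℝ,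
          IsGreatest {μ : ℝ | ∃ i, hB.1.eigenvalues i = μ} lam1 →
          IsLeast {μ : ℝ | (∃ i, hB.1.eigenvalues i = μ) ∧ μ ≠ 0} lamr →
        ∀ b : Fin n → ℂ, (∃ z, B *ᵥ z = b) →
        ∀ ybar : Fin n → ℂ, B *ᵥ ybar = b →
        ∀ ω : ℝ, 0 < ω → ω < 2 →
          ∃ σ : Equiv.Perm (Fin n),
            ∀ y : ℕ → Fin n → ℂ,
              (∀ k, y (k+1) = sorStepPerm B ω b σ (y k)) →
              ∀ k : ℕ, 1 ≤ k →
                energySq B (ybar - y k) ≤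
                  (1 - ω*(2-ω)*lam1 / ((1 + C₁*ω*lam1)^2 * (lam1/lamr)))^k *
                    energySq B (ybar - y 0) := by
  refine ⟨20, by norm_num, ?_⟩
  intro n B hB hdiag lam1 lamr hgr hls b _ ybar hybar ω hω hω2
  obtain ⟨i₀, hi₀⟩ := hgr.1
  have : NeZero n := ⟨fun h => (h ▸ i₀).elim0⟩
  have hle := hB.1.energySq_le_of_eigenvalues_le fun i => hgr.2 ⟨i, rfl⟩
  have hlam : 1 ≤ lam1 := one_le_of_energySq_le hdiag hle
  have hc := hB.mul_energySq_le_nsq_mulVec fun i hi => hls.2 ⟨⟨i, rfl⟩, hi⟩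
  obtain ⟨⟨i₁, hi₁⟩, hr0⟩ := hls.1
  have hr : 0 < lamr := (hi₁ ▸ hB.eigenvalues_nonneg i₁ : 0 ≤ lamr).lt_of_ne hr0.symm
  have hr1 : lamr ≤ lam1 := hgr.2 ⟨i₁, hi₁⟩
  have hl0 : 0 < lam1 := by linarith
  obtain ⟨ρ, hρ, hn⟩ := (formBounded_sub_one hB hdiag hle hlam).hasOrdering hl0
  rw [lowerPart_sub_one] at hn
  refine ⟨Tuple.sort ρ, fun y hy k hk => ?_⟩
  clear hk
  have hσ : StrictMono (ρ ∘ Tuple.sort ρ) :=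
    (Tuple.monotone_sort ρ).strictMono_of_injective (hρ.comp (Tuple.sort ρ).injective)
  have hq : 1 - ω * (2 - ω) * lam1 / ((1 + 20 * ω * lam1) ^ 2 * (lam1 / lamr))
      = 1 - ω * (2 - ω) * (lamr / (1 + ω * (20 * lam1)) ^ 2) := by
    have : 0 < 1 + 20 * ω * lam1 := by positivity
    have : 0 < 1 + ω * (20 * lam1) := by positivity
    field_simp
  have hq0 : 0 ≤ 1 - ω * (2 - ω) * (lamr / (1 + ω * (20 * lam1)) ^ 2) := by
    have hωl : 0 < ω * lam1 := by positivity
    rw [← mul_div_assoc, sub_nonneg, div_le_one (by positivity)]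
    nlinarith [mul_pos hω hr, mul_le_mul_of_nonneg_left hr1 hω.le, mul_pos (mul_pos hω hr) hω]
  rw [hq]
  induction k with
  | zero => simp
  | succ k ih =>
    obtain ⟨u, hu, hu'⟩ := exists_sorStepPerm_eq hσ B ω b (y k)
    rw [← hybar, ← mulVec_sub] at hu'
    have := energySq_sor_error_le hρ hB hdiag hω hω2 (by positivity) hn hc hu'
    rw [hy, hu, ← sub_sub, pow_succ', mul_assoc]
    exact this.trans (mul_le_mul_of_nonneg_left ih hq0)
end

section
/- Let B be an n×n complex Hermitian matrix with unit diagonal, L its strictly lower triangular part, ω ∈ ℝ, and Q = I − ω(I + ωL)^{-1}B. Then for every y ∈ ℂⁿ: ⟨B Qy, Qy⟩ = ⟨By, y⟩ − ω(2−ω)‖(I + ωL)^{-1}By‖², where ‖·‖ is the Euclidean norm. (Note that I + ωL is unitriangular, hence invertible.) -/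
open Matrix
open scoped ComplexOrder

theorem one_add_smul_lowerTri_isUnit_det {n : ℕ} (B : Matrix (Fin n) (Fin n) ℂ) (c : ℂ) :
    IsUnit (1 + c • lowerTri B).det := by
  rw [Matrix.det_of_isLowerTriangular]
  · simp [lowerTri]
  · intro i j hij
    have h : i < j := hij
    simp [lowerTri, h.ne, h.not_gt]

theorem lowerTri_add_conjTranspose {n : ℕ} {B : Matrix (Fin n) (Fin n) ℂ}
    (hB : B.IsHermitian) (hdiag : ∀ i, B i i = 1) :
    lowerTri B + (lowerTri B)ᴴ = B - 1 := by
  ext i j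
  rcases lt_trichotomy i j with h | h | h
  · simp [lowerTri, h, h.not_gt, h.ne, ← hB.apply i j]
  · subst h; simp [lowerTri, hdiag]
  · simp [lowerTri, h, h.not_gt, h.ne']

theorem euclNorm_sq_eq_dotProduct {n : ℕ} (v : Fin n → ℂ) :
    ((euclNorm v ^ 2 : ℝ) : ℂ) = star v ⬝ᵥ v := by
  rw [euclNorm, EuclideanSpace.norm_sq_eq]
  simp [dotProduct, Complex.conj_mul']

/-- Energy identity for the SOR error iteration matrix Q = I − ω(I+ωL)⁻¹B:
⟨BQy, Qy⟩ = ⟨By, y⟩ − ω(2−ω)‖(I+ωL)⁻¹By‖². -/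
theorem sor_energy_identity {n : ℕ} (B : Matrix (Fin n) (Fin n) ℂ)
    (hB : B.IsHermitian) (hdiag : ∀ i, B i i = 1) (ω : ℝ)
    (Q : Matrix (Fin n) (Fin n) ℂ)
    (hQ : Q = 1 - (ω : ℂ) • ((1 + (ω : ℂ) • lowerTri B)⁻¹ * B))
    (y : Fin n → ℂ) :
    star (Q *ᵥ y) ⬝ᵥ (B *ᵥ (Q *ᵥ y)) =
      star y ⬝ᵥ (B *ᵥ y) -
        ((ω * (2 - ω) : ℝ) : ℂ) *
          (((euclNorm ((1 + (ω : ℂ) • lowerTri B)⁻¹ *ᵥ (B *ᵥ y)))^2 : ℝ) : ℂ) := by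
  set A : Matrix (Fin n) (Fin n) ℂ := 1 + (ω : ℂ) • lowerTri B with hA
  set r := A⁻¹ *ᵥ (B *ᵥ y) with hr
  have hAr : A *ᵥ r = B *ᵥ y := by
    rw [hr, mulVec_mulVec, mul_nonsing_inv A (one_add_smul_lowerTri_isUnit_det B ω), one_mulVec]
  have hQy : Q *ᵥ y = y - (ω : ℂ) • r := by
    rw [hQ, sub_mulVec, one_mulVec, smul_mulVec, ← mulVec_mulVec]
  have hAA : A + Aᴴ = ((2 - ω : ℝ) : ℂ) • (1 : Matrix (Fin n) (Fin n) ℂ) + (ω : ℂ) • B := by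
    rw [hA, conjTranspose_add, conjTranspose_one, conjTranspose_smul, Complex.star_def,
      Complex.conj_ofReal]
    calc _ = (2 : ℂ) • (1 : Matrix (Fin n) (Fin n) ℂ)
          + (ω : ℂ) • (lowerTri B + (lowerTri B)ᴴ) := by module
      _ = _ := by
        rw [lowerTri_add_conjTranspose hB hdiag]
        push_cast
        module
  clear_value r
  have hyBr : star y ⬝ᵥ (B *ᵥ r) = star r ⬝ᵥ (Aᴴ *ᵥ r) := by
    calc star y ⬝ᵥ (B *ᵥ r) = star (A *ᵥ r) ⬝ᵥ r := by
          rw [hAr, star_mulVec, hB.eq, dotProduct_mulVec]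
      _ = star r ⬝ᵥ (Aᴴ *ᵥ r) := by rw [star_mulVec, dotProduct_mulVec]
  have key : star r ⬝ᵥ (B *ᵥ y) + star y ⬝ᵥ (B *ᵥ r) =
      ((2 - ω : ℝ) : ℂ) * (star r ⬝ᵥ r) + ω * (star r ⬝ᵥ (B *ᵥ r)) := by
    rw [hyBr, ← hAr, ← dotProduct_add, ← add_mulVec, hAA, add_mulVec, smul_mulVec, smul_mulVec,
      one_mulVec, dotProduct_add, dotProduct_smul, dotProduct_smul, smul_eq_mul, smul_eq_mul]
  rw [euclNorm_sq_eq_dotProduct, hQy]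
  simp only [star_sub, star_smul, Complex.star_def, Complex.conj_ofReal, mulVec_sub, mulVec_smul,
    sub_dotProduct, dotProduct_sub, smul_dotProduct, dotProduct_smul, smul_eq_mul]
  push_cast at key ⊢
  linear_combination (-(ω : ℂ)) * key
end
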